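/- Let M be an ℵ₀-saturated real closed field. The set of infinitesimal elements I := {x ∈ M : for all n ∈ ℤ_{>0}, −1/n < x < 1/n} is an ∞-definable subgroup of the additive group (M,+), and there is no proper definable subgroup of (M,+) containing I; that is, any definable (with parameters) subgroup of (M,+) containing I equals M. -/

import Mathlib

/-! # Common framework: partial types, definable types, pro-definable sets and groups -/

namespace PaperGroups

open FirstOrder FirstOrder.Language Set

/-- An *instance* `φ(x; m)`: a formula `φ` whose free variables are split into the
variables `ι` of the type and a finite tuple of parameter variables, together with a
tuple `m` of parameters from `M`. -/
structure Inst (L : FirstOrder.Language.{0, 0}) (M : Type) (ι : Type) where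
  n : ℕ
  φ : L.Formula (ι ⊕ Fin n)
  m : Fin n → M

variable {L : FirstOrder.Language.{0, 0}} {M : Type} [L.Structure M] {ι κ μ : Type}

/-- The instance `φ(x;m)` holds of the tuple `a`. -/
def Inst.Holds (I : Inst L M ι) (a : ι → M) : Prop :=
  I.φ.Realize (Sum.elim a I.m)

/-- `a` realizes the set of instances `p`. -/
def Realizes (a : ι → M) (p : Set (Inst L M ι)) : Prop := ∀ I ∈ p, I.Holds a

/-- The set of realizations (in `M`) of a set of instances. -/
def realizSet (p : Set (Inst L M ι)) : Set (ι → M) := {a | Realizes a p}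

/-- Semantic entailment (in the monster model `M`). -/
def Entails (p : Set (Inst L M ι)) (I : Inst L M ι) : Prop :=
  ∀ a : ι → M, Realizes a p → I.Holds a

/-- A partial type over `M` (identified with its deductive closure): a consistent set of
instances closed under implication. -/
structure IsPartialType (p : Set (Inst L M ι)) : Prop where
  consistent : ∃ a : ι → M, Realizes a p
  closed : ∀ I : Inst L M ι, Entails p I → I ∈ p

/-- A complete type over `M`: a partial type deciding every instance. -/
structure IsCompleteType (p : Set (Inst L M ι)) : Prop where
  toIsPartialType : IsPartialType p
  complete : ∀ I : Inst L M ι, I ∈ p ∨ (⟨I.n, I.φ.not, I.m⟩ : Inst L M ι) ∈ p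

/-- `p` is `L(A)`-definable: for every formula `φ(x;y)` the set of parameter tuples `m`
with `p ⊢ φ(x;m)` is definable over `A`. -/
def DefinableOver (p : Set (Inst L M ι)) (A : Set M) : Prop :=
  ∀ (n : ℕ) (φ : L.Formula (ι ⊕ Fin n)),
    A.Definable L {m : Fin n → M | (⟨n, φ, m⟩ : Inst L M ι) ∈ p}

/-- `p` concentrates on the set `X`: `p ⊢ x ∈ X`. -/
def ConcentratesOn (p : Set (Inst L M ι)) (X : Set (ι → M)) : Prop :=
  realizSet p ⊆ X

/-- Restriction `p|_B` of a set of instances to those with parameters in `B`. -/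
def restrictTo (p : Set (Inst L M ι)) (B : Set M) : Set (Inst L M ι) :=
  {I ∈ p | ∀ i, I.m i ∈ B}

/-- The pushforward `f₊p = {φ(y;z) : φ(f(x);z) ∈ p}` of a partial type under a map
(defined semantically, types being identified with their deductive closures). -/
def pushforward (f : (ι → M) → (κ → M)) (p : Set (Inst L M ι)) : Set (Inst L M κ) :=
  {I | ∀ a : ι → M, Realizes a p → I.Holds (f a)}

/-- The tensor product `p ⊗ q` of two `L(A)`-definable partial types. -/
def tensor (A : Set M) (p : Set (Inst L M ι)) (q : Set (Inst L M κ)) :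
    Set (Inst L M (ι ⊕ κ)) :=
  {I | ∀ a : ι → M, Realizes a (restrictTo p (A ∪ Set.range I.m)) →
      ∀ b : κ → M, Realizes b (restrictTo q (A ∪ Set.range I.m ∪ Set.range a)) →
      I.Holds (Sum.elim a b)}

/-- The image of an instance under a map of parameters. -/
def Inst.map (g : M → M) (I : Inst L M ι) : Inst L M ι := ⟨I.n, I.φ, g ∘ I.m⟩

/-- The image `σ(p)` of a set of instances under a map (e.g. an automorphism) `σ`. -/
def typeMap (g : M → M) (p : Set (Inst L M ι)) : Set (Inst L M ι) := Inst.map g '' p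

/-- A type-definable ("pro-definable", viewed as a set of points in possibly infinitely
many variables) set over `A`: an intersection of `A`-definable conditions. -/
def TypeDefinableOver (L : FirstOrder.Language.{0, 0}) [L.Structure M] (A : Set M)
    (X : Set (ι → M)) : Prop :=
  ∃ F : Set (Set (ι → M)), (∀ s ∈ F, A.Definable L s) ∧ X = ⋂₀ F

/-- A pro-`L(A)`-definable function on `X`: a function whose graph (over `X`) is
pro-definable over `A`. -/
def ProDefFunOn (L : FirstOrder.Language.{0, 0}) [L.Structure M] (A : Set M)
    (X : Set (ι → M)) (f : (ι → M) → (κ → M)) : Prop :=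
  TypeDefinableOver L A
    {z : (ι ⊕ κ) → M | z ∘ Sum.inl ∈ X ∧ z ∘ Sum.inr = f (z ∘ Sum.inl)}

/-- The set of pairs from `X` and `Y`, as a set in the disjoint union of the variables. -/
def pairSet (X : Set (ι → M)) (Y : Set (κ → M)) : Set ((ι ⊕ κ) → M) :=
  {z | z ∘ Sum.inl ∈ X ∧ z ∘ Sum.inr ∈ Y}

/-- Uncurrying a binary function on tuples. -/
def uncurry₂ (f : (ι → M) → (κ → M) → (μ → M)) : ((ι ⊕ κ) → M) → (μ → M) :=
  fun z => f (z ∘ Sum.inl) (z ∘ Sum.inr)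

/-- A pro-`L(A)`-definable binary function on `X × Y`. -/
def ProDefFun₂ (L : FirstOrder.Language.{0, 0}) [L.Structure M] (A : Set M)
    (X : Set (ι → M)) (Y : Set (κ → M)) (f : (ι → M) → (κ → M) → (μ → M)) : Prop :=
  ProDefFunOn L A (pairSet X Y) (uncurry₂ f)

/-- A pro-`L(A)`-definable group, viewed through its points: a type-definable set in the
variables `ι` together with a pro-definable group law. -/
structure ProDefGroup (L : FirstOrder.Language.{0, 0}) (M : Type) [L.Structure M]
    (A : Set M) (ι : Type) where
  carrier : Set (ι → M)
  mul : (ι → M) → (ι → M) → (ι → M)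
  one : ι → M
  inv : (ι → M) → (ι → M)
  carrier_typeDef : TypeDefinableOver L A carrier
  mul_proDef : ProDefFun₂ L A carrier carrier mul
  inv_proDef : ProDefFunOn L A carrier inv
  one_mem : one ∈ carrier
  mul_mem : ∀ x ∈ carrier, ∀ y ∈ carrier, mul x y ∈ carrier
  inv_mem : ∀ x ∈ carrier, inv x ∈ carrier
  mul_assoc : ∀ x ∈ carrier, ∀ y ∈ carrier, ∀ z ∈ carrier, mul (mul x y) z = mul x (mul y z)
  one_mul : ∀ x ∈ carrier, mul one x = x
  mul_one : ∀ x ∈ carrier, mul x one = x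
  inv_mul : ∀ x ∈ carrier, mul (inv x) x = one

/-- The translate `g ⋅ p := {φ(x;y) : p ⊢ φ(g⋅x;y)}` of a partial type by a group
element. -/
def ProDefGroup.translate {A : Set M} (G : ProDefGroup L M A ι) (g : ι → M)
    (p : Set (Inst L M ι)) : Set (Inst L M ι) :=
  pushforward (G.mul g) p

/-- `p` is a `d`-generic of `G` over `A'`: it concentrates on `G` and all of its
translates are `L(A')`-definable. -/
def IsDGeneric {A : Set M} (G : ProDefGroup L M A ι) (p : Set (Inst L M ι))
    (A' : Set M) : Prop :=
  ConcentratesOn p G.carrier ∧ ∀ g ∈ G.carrier, DefinableOver (G.translate g p) A'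

/-- `p` is `G(M)`-invariant. -/
def ProDefGroup.Invariant {A : Set M} (G : ProDefGroup L M A ι)
    (p : Set (Inst L M ι)) : Prop :=
  ∀ g ∈ G.carrier, G.translate g p = p

/-- A pro-`L(A)`-definable group chunk `(F, H, K)` over the partial type `p`. -/
structure IsGroupChunk (L : FirstOrder.Language.{0, 0}) [L.Structure M] (A : Set M)
    (p : Set (Inst L M ι)) (F H K : (ι → M) → (ι → M) → (ι → M)) : Prop where
  F_proDef : ProDefFun₂ L A (realizSet p) (realizSet p) F
  H_proDef : ProDefFun₂ L A (realizSet p) (realizSet p) H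
  K_proDef : ProDefFun₂ L A (realizSet p) (realizSet p) K
  gen_inv : ∀ a : ι → M, Realizes a (restrictTo p A) → pushforward (F a) p = p
  cancel_left : ∀ c : (ι ⊕ ι) → M, Realizes c (tensor A p p) →
    H (c ∘ Sum.inl) (F (c ∘ Sum.inl) (c ∘ Sum.inr)) = c ∘ Sum.inr
  cancel_right : ∀ c : (ι ⊕ ι) → M, Realizes c (tensor A p p) →
    K (F (c ∘ Sum.inl) (c ∘ Sum.inr)) (c ∘ Sum.inr) = c ∘ Sum.inl
  assoc : ∀ c : ((ι ⊕ ι) ⊕ ι) → M, Realizes c (tensor A (tensor A p p) p) →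
    F (c ∘ Sum.inl ∘ Sum.inl) (F (c ∘ Sum.inl ∘ Sum.inr) (c ∘ Sum.inr)) =
      F (F (c ∘ Sum.inl ∘ Sum.inl) (c ∘ Sum.inl ∘ Sum.inr)) (c ∘ Sum.inr)

/-- An `L(A)`-definable group (in finitely many variables). -/
structure DefGroupOn (L : FirstOrder.Language.{0, 0}) (M : Type) [L.Structure M]
    (A : Set M) (n : ℕ) where
  carrier : Set (Fin n → M)
  mul : (Fin n → M) → (Fin n → M) → (Fin n → M)
  one : Fin n → M
  inv : (Fin n → M) → (Fin n → M)
  carrier_def : A.Definable L carrier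
  mul_def : A.Definable L {z : ((Fin n ⊕ Fin n) ⊕ Fin n) → M |
    z ∘ Sum.inl ∘ Sum.inl ∈ carrier ∧ z ∘ Sum.inl ∘ Sum.inr ∈ carrier ∧
    mul (z ∘ Sum.inl ∘ Sum.inl) (z ∘ Sum.inl ∘ Sum.inr) = z ∘ Sum.inr}
  inv_def : A.Definable L {z : Fin n ⊕ Fin n → M |
    z ∘ Sum.inl ∈ carrier ∧ inv (z ∘ Sum.inl) = z ∘ Sum.inr}
  one_mem : one ∈ carrier
  mul_mem : ∀ x ∈ carrier, ∀ y ∈ carrier, mul x y ∈ carrier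
  inv_mem : ∀ x ∈ carrier, inv x ∈ carrier
  mul_assoc : ∀ x ∈ carrier, ∀ y ∈ carrier, ∀ z ∈ carrier, mul (mul x y) z = mul x (mul y z)
  one_mul : ∀ x ∈ carrier, mul one x = x
  mul_one : ∀ x ∈ carrier, mul x one = x
  inv_mul : ∀ x ∈ carrier, mul (inv x) x = one

/-- The translate of a partial type by an element of a definable group. -/
def DefGroupOn.translate {A : Set M} {n : ℕ} (G : DefGroupOn L M A n) (g : Fin n → M)
    (p : Set (Inst L M (Fin n))) : Set (Inst L M (Fin n)) :=
  pushforward (G.mul g) p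

/-- `M` is `κ`-saturated: every small finitely satisfiable set of instances is realized. -/
def IsSaturated (L : FirstOrder.Language.{0, 0}) (M : Type) [L.Structure M]
    (κ : Cardinal) : Prop :=
  ∀ (ι : Type) (p : Set (Inst L M ι)), Cardinal.mk ι < κ → Cardinal.mk p < κ →
    (∀ s : Finset (Inst L M ι), ↑s ⊆ p → ∃ a : ι → M, ∀ I ∈ s, I.Holds a) →
    ∃ a : ι → M, Realizes a p

/-- `M` is strongly `κ`-homogeneous: every partial elementary map between small subsets
extends to an automorphism. -/
def IsStronglyHomogeneous (L : FirstOrder.Language.{0, 0}) (M : Type) [L.Structure M]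
    (κ : Cardinal) : Prop :=
  ∀ (A : Set M) (f : A → M), Cardinal.mk A < κ →
    (∀ (k : ℕ) (φ : L.Formula (Fin k)) (v : Fin k → A),
      (φ.Realize (fun i => (v i : M)) ↔ φ.Realize (fun i => f (v i)))) →
    ∃ σ : M ≃[L] M, ∀ a : A, σ a = f a

/-- `M` eliminates imaginaries: every definable set (with parameters) has a canonical
parameter, i.e. a finite real tuple with the same pointwise automorphism stabilizer. -/
def EliminatesImaginaries (L : FirstOrder.Language.{0, 0}) (M : Type) [L.Structure M] : Prop :=
  ∀ (k : ℕ) (S : Set (Fin k → M)), (Set.univ : Set M).Definable L S →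
    ∃ (r : ℕ) (c : Fin r → M), ∀ σ : M ≃[L] M,
      ((fun v : Fin k → M => (σ : M → M) ∘ v) '' S = S) ↔ ∀ i, σ (c i) = c i

/-- The (syntactic) definable closure of `A`. -/
def dclSet (L : FirstOrder.Language.{0, 0}) (M : Type) [L.Structure M] (A : Set M) :
    Set M :=
  {a | A.Definable₁ L {a}}

/-- The (syntactic) algebraic closure of `A`. -/
def aclSet (L : FirstOrder.Language.{0, 0}) (M : Type) [L.Structure M] (A : Set M) :
    Set M :=
  {a | ∃ s : Set M, a ∈ s ∧ s.Finite ∧ A.Definable₁ L s}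

end PaperGroups

namespace PaperGroups

open FirstOrder FirstOrder.Language FirstOrder.Ring

/-- The language of ordered rings: the language of rings together with an order. -/
def ordRing : FirstOrder.Language.{0, 0} := Language.ring.sum Language.order

variable {M : Type} [Field M] [LinearOrder M] [IsStrictOrderedRing M]

noncomputable instance : CompatibleRing M := compatibleRingOfRing M

instance : Language.order.Structure M := orderStructure M

noncomputable instance : ordRing.Structure M := Language.sumStructure _ _ M

/-- `M` is a real closed field: an ordered field in which every nonnegative element is a
square and every odd-degree polynomial has a root. -/
def IsRealClosed (M : Type) [Field M] [LinearOrder M] [IsStrictOrderedRing M] : Prop :=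
  (∀ x : M, 0 ≤ x → ∃ y : M, y ^ 2 = x) ∧
    ∀ P : Polynomial M, Odd P.natDegree → ∃ x : M, P.eval x = 0

/-- `M` is `ℵ₀`-saturated: every finitely satisfiable countable set of formulas with
parameters in a finite subset of `M` is realized in `M`. -/
def Aleph0Saturated (L : FirstOrder.Language.{0, 0}) (M : Type) [L.Structure M] : Prop :=
  ∀ (k : ℕ) (p : Set (Inst L M (Fin k))), p.Countable →
    (∃ B : Set M, B.Finite ∧ ∀ I ∈ p, ∀ i, I.m i ∈ B) →
    (∀ s : Finset (Inst L M (Fin k)), ↑s ⊆ p → ∃ a : Fin k → M, ∀ I ∈ s, I.Holds a) →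
    ∃ a : Fin k → M, Realizes a p

/-- The set of infinitesimal elements of an ordered field. -/
def infinitesimals (M : Type) [Field M] [LinearOrder M] [IsStrictOrderedRing M] : Set M :=
  {x : M | ∀ n : ℕ, 0 < n → -(1 / (n : M)) < x ∧ x < 1 / (n : M)}

end PaperGroups

namespace RCFAux
open Polynomial

theorem quad_gen {F E : Type*} [Field F] [Field E] [Algebra F E] [CharZero F]
    (h : Module.finrank F E = 2) :
    ∃ β : E, (∀ r : F, algebraMap F E r ≠ β) ∧ ∃ d : F, β ^ 2 = algebraMap F E d := by
  have hfd : FiniteDimensional F E := Module.finite_of_finrank_pos (by omega)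
  have h1 : ∃ α : E, ∀ r : F, algebraMap F E r ≠ α := by
    by_contra hcon
    push Not at hcon
    have : Module.finrank F E = 1 := by
      rw [finrank_eq_one_iff']
      refine ⟨1, one_ne_zero, fun w => ?_⟩
      obtain ⟨r, hr⟩ := hcon w
      exact ⟨r, by rw [← hr, Algebra.smul_def, mul_one]⟩
    omega
  obtain ⟨α, hα⟩ := h1
  have hintg : IsIntegral F α := IsIntegral.of_finite F α
  have hdeg : (minpoly F α).natDegree ≤ 2 := h ▸ minpoly.natDegree_le α
  have hdeg' : (minpoly F α).degree ≤ 2 := by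
    exact Polynomial.natDegree_le_iff_degree_le.1 hdeg
  have hne1 : (minpoly F α).natDegree ≠ 1 := by
    intro h1
    have := (minpoly.natDegree_eq_one_iff (A := F) (x := α)).1 h1
    obtain ⟨r, hr⟩ := this
    exact hα r hr
  have hpos : 0 < (minpoly F α).natDegree := minpoly.natDegree_pos hintg
  have h2 : (minpoly F α).natDegree = 2 := by omega
  have hmon := minpoly.monic hintg
  have hq := Polynomial.eq_quadratic_of_degree_le_two hdeg'
  have hc : (minpoly F α).coeff 2 = 1 := by rw [← h2]; exact hmon
  have hev := minpoly.aeval F α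
  rw [hq, hc] at hev
  simp at hev
  set b := (minpoly F α).coeff 1
  set c := (minpoly F α).coeff 0
  refine ⟨α + algebraMap F E (b / 2), fun r hr => hα (r - b/2) ?_, b^2/4 - c, ?_⟩
  · rw [map_sub, hr]; ring
  · have : CharZero E := charZero_of_injective_algebraMap (algebraMap F E).injective
    simp only [map_sub, map_div₀, map_pow, map_ofNat]
    field_simp
    linear_combination 16 * hev

theorem no_quad_of_sq {F E : Type*} [Field F] [Field E] [Algebra F E] [CharZero F]
    (hs : ∀ x : F, ∃ y, y ^ 2 = x) (h : Module.finrank F E = 2) : False := by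
  obtain ⟨β, hβ, d, hd⟩ := quad_gen h
  obtain ⟨y, rfl⟩ := hs d
  rw [map_pow, sq_eq_sq_iff_eq_or_eq_neg] at hd
  rcases hd with hd | hd
  · exact hβ y hd.symm
  · exact hβ (-y) (by rw [hd, map_neg])

variable {M : Type*} [Field M] [LinearOrder M] [IsStrictOrderedRing M]

theorem sq_of_quad {E : Type*} [Field E] [Algebra M E]
    (hsq : ∀ x : M, 0 ≤ x → ∃ y : M, y ^ 2 = x)
    (h : Module.finrank M E = 2) (z : E) : ∃ w : E, w ^ 2 = z := by
  have hfd : FiniteDimensional M E := Module.finite_of_finrank_pos (by omega)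
  obtain ⟨β, hβ, d, hd⟩ := quad_gen h
  have hdneg : d < 0 := by
    by_contra hcon
    obtain ⟨y, rfl⟩ := hsq d (not_lt.1 hcon)
    rw [map_pow, sq_eq_sq_iff_eq_or_eq_neg] at hd
    rcases hd with hd | hd
    · exact hβ y hd.symm
    · exact hβ (-y) (by rw [hd, map_neg])
  have hli : LinearIndependent M ![(1:E), β] := by
    rw [LinearIndependent.pair_iff]
    intro s t hst
    have ht : t = 0 := by
      by_contra ht
      apply hβ (-s / t)
      have : algebraMap M E t ≠ 0 := by simpa using ht
      rw [map_div₀, map_neg]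
      rw [Algebra.smul_def, Algebra.smul_def] at hst
      field_simp
      linear_combination (-1 : E) * hst
    subst ht
    simpa using hst
  have hspan := hli.span_eq_top_of_card_eq_finrank' (by simp [h])
  have hz : z ∈ Submodule.span M (Set.range ![(1:E), β]) := by rw [hspan]; trivial
  simp only [Matrix.range_cons, Matrix.range_empty, Set.union_empty, Set.singleton_union] at hz
  rw [Submodule.mem_span_pair] at hz
  obtain ⟨x, y', hz⟩ := hz
  obtain ⟨e, he⟩ := hsq (-d) (by linarith)
  have he0 : e ≠ 0 := by rintro rfl; apply hdneg.ne; linarith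
  -- z = x + y i where i = β / e
  set y := y' * e with hy
  obtain ⟨r0, hr0⟩ := hsq (x^2 + y^2) (by positivity)
  set r := |r0| with hr
  have hrsq : r^2 = x^2+y^2 := by rw [hr, sq_abs, hr0]
  have hrx : |x| ≤ r := abs_le_of_sq_le_sq (by nlinarith [sq_nonneg y]) (abs_nonneg _)
  have hx1 := abs_le.1 hrx
  obtain ⟨u, hu⟩ := hsq ((r+x)/2) (by linarith)
  obtain ⟨v, hv⟩ := hsq ((r-x)/2) (by linarith)
  have huv : (2*u*v)^2 = y^2 := by
    have : (2*u*v)^2 = 4 * u^2*v^2 := by ring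
    rw [this, hu, hv]; linear_combination hrsq
  have key : ∀ v : M, u^2 - v^2 = x → 2*u*v = y → ∃ w : E, w^2 = z := by
    intro v h1 h2
    refine ⟨algebraMap M E u + algebraMap M E (v / e) * β, ?_⟩
    rw [← hz, Algebra.smul_def, Algebra.smul_def, mul_one]
    have : (algebraMap M E u + algebraMap M E (v / e) * β)^2 =
      algebraMap M E u ^2 + algebraMap M E (v/e)^2 * β^2 + algebraMap M E (2 * u * (v/e)) * β := by
      simp only [map_mul, map_ofNat]; ring
    rw [this, hd, ← map_pow, ← map_pow, ← map_mul, ← map_add]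
    congr 2
    · rw [← h1, div_pow]
      have : d = - e^2 := by linarith
      rw [this]; field_simp; ring
    · congr 1
      field_simp; rw [h2, hy, mul_comm]
  rw [sq_eq_sq_iff_eq_or_eq_neg] at huv
  rcases huv with h1 | h1
  · exact key v (by rw [hu, hv]; ring) h1
  · exact key (-v) (by rw [neg_sq, hu, hv]; ring) (by linear_combination -h1)

theorem finrank_odd {E : Type*} [Field E] [Algebra M E] [FiniteDimensional M E]
    (hodd : ∀ P : M[X], Odd P.natDegree → ∃ x : M, P.eval x = 0)
    (h : Odd (Module.finrank M E)) : Module.finrank M E = 1 := by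
  obtain ⟨α, hα⟩ := Field.exists_primitive_element M E
  have hintg : IsIntegral M α := IsIntegral.of_finite M α
  have h1 : Module.finrank M E = (minpoly M α).natDegree := by
    rw [← IntermediateField.adjoin.finrank hintg, hα, IntermediateField.finrank_top']
  rw [h1] at h ⊢
  obtain ⟨x, hx⟩ := hodd _ h
  exact natDegree_eq_of_degree_eq_some
    (degree_eq_one_of_irreducible_of_root (minpoly.irreducible hintg) hx)

theorem finrank_gal_le {E : Type*} [Field E] [Algebra M E] [FiniteDimensional M E] [IsGalois M E]
    (hsq : ∀ x : M, 0 ≤ x → ∃ y : M, y ^ 2 = x)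
    (hodd : ∀ P : M[X], Odd P.natDegree → ∃ x : M, P.eval x = 0) :
    Module.finrank M E ≤ 2 := by
  have : Fact (Nat.Prime 2) := ⟨Nat.prime_two⟩
  -- power of two
  have hpow : ∃ n, Module.finrank M E = 2 ^ n := by
    obtain ⟨P⟩ : Nonempty (Sylow 2 (E ≃ₐ[M] E)) := inferInstance
    have hP := P.isPGroup'
    obtain ⟨n, hn⟩ := (IsPGroup.iff_card).1 hP
    have hmul := Module.finrank_mul_finrank M (IntermediateField.fixedField (P : Subgroup (E ≃ₐ[M] E))) E
    have hidx := IntermediateField.finrank_eq_fixingSubgroup_index E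
      (IntermediateField.fixedField (P : Subgroup (E ≃ₐ[M] E)))
    rw [IntermediateField.fixingSubgroup_fixedField] at hidx
    have hnd : ¬ 2 ∣ (P : Subgroup (E ≃ₐ[M] E)).index := P.not_dvd_index
    have h1 := finrank_odd (E := IntermediateField.fixedField (P : Subgroup (E ≃ₐ[M] E))) hodd (by
      rw [hidx, ← Nat.not_even_iff_odd, even_iff_two_dvd]; exact hnd)
    rw [h1, one_mul, IntermediateField.finrank_fixedField_eq_card] at hmul
    exact ⟨n, by rw [← hmul]; exact hn⟩
  obtain ⟨n, hn⟩ := hpow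
  rcases n with _ | n
  · omega
  have hcard : Nat.card (E ≃ₐ[M] E) = 2^(n+1) := by rw [IsGalois.card_aut_eq_finrank, hn]
  obtain ⟨H, hH⟩ := Sylow.exists_subgroup_card_pow_prime (G := E ≃ₐ[M] E) 2 (n := n)
    (by rw [hcard]; exact pow_dvd_pow _ (by omega))
  let F1 := IntermediateField.fixedField H
  have hF1E : Module.finrank F1 E = 2 ^ n := by
    rw [IntermediateField.finrank_fixedField_eq_card, hH]
  have hF1 : Module.finrank M F1 = 2 := by
    have := Module.finrank_mul_finrank M F1 E
    rw [hF1E, hn, pow_succ, mul_comm] at this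
    exact Nat.eq_of_mul_eq_mul_left (by positivity) this
  rcases n with _ | n
  · omega
  exfalso
  have hsq1 := sq_of_quad hsq hF1
  have hcard1 : Nat.card (E ≃ₐ[F1] E) = 2^(n+1) := by rw [IsGalois.card_aut_eq_finrank, hF1E]
  obtain ⟨H1, hH1⟩ := Sylow.exists_subgroup_card_pow_prime (G := E ≃ₐ[F1] E) 2 (n := n)
    (by rw [hcard1]; exact pow_dvd_pow _ (by omega))
  have hF2 : Module.finrank F1 (IntermediateField.fixedField H1) = 2 := by
    have := Module.finrank_mul_finrank F1 (IntermediateField.fixedField H1) E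
    rw [hF1E, IntermediateField.finrank_fixedField_eq_card, hH1, pow_succ, mul_comm] at this
    exact Nat.eq_of_mul_eq_mul_left (by positivity) this
  exact no_quad_of_sq hsq1 hF2

theorem irred_natDegree_le (hsq : ∀ x : M, 0 ≤ x → ∃ y : M, y ^ 2 = x)
    (hodd : ∀ P : M[X], Odd P.natDegree → ∃ x : M, P.eval x = 0)
    (p : M[X]) (hp : Irreducible p) : p.natDegree ≤ 2 := by
  have : IsGalois M p.SplittingField := IsGalois.of_separable_splitting_field (p := p) hp.separable
  have h1 := finrank_gal_le (E := p.SplittingField) hsq hodd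
  have : Fact (Irreducible p) := ⟨hp⟩
  have hdeg : p.degree ≠ 0 := (degree_pos_of_irreducible hp).ne'
  have hroot := (SplittingField.splits p).exists_eval_eq_zero (by rwa [degree_map])
  obtain ⟨a, ha⟩ := hroot
  have ha' : aeval a p = 0 := by rwa [eval_map, ← aeval_def] at ha
  have h2 := minpoly.natDegree_le (A := M) a
  have h3 : Associated (minpoly M a) p :=
    (minpoly.irreducible (IsIntegral.of_finite M a)).associated_of_dvd hp (minpoly.dvd M a ha')
  rw [← natDegree_eq_of_degree_eq (degree_eq_degree_of_associated h3)]
  omega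

theorem irred_sign (hsq : ∀ x : M, 0 ≤ x → ∃ y : M, y ^ 2 = x)
    (hodd : ∀ P : M[X], Odd P.natDegree → ∃ x : M, P.eval x = 0)
    (p : M[X]) (hp : Irreducible p) (a b : M) (hab : a ≤ b) (h : p.eval a * p.eval b < 0) :
    ∃ c, a < c ∧ c < b ∧ p.eval c = 0 := by
  have hd := irred_natDegree_le hsq hodd p hp
  have hq := eq_quadratic_of_degree_le_two (natDegree_le_iff_degree_le.1 hd)
  set A := p.coeff 2
  set B := p.coeff 1
  set C' := p.coeff 0
  have hev : ∀ x, p.eval x = A * (x * x) + B * x + C' := by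
    intro x; rw [hq]; simp only [eval_add, eval_mul, eval_C, eval_pow, eval_X]; ring
  by_cases hA : A = 0
  · have hB : B ≠ 0 := by
      intro hB
      rw [hev, hev, hA, hB] at h
      nlinarith [mul_self_nonneg C']
    have hC : C' = B * (C'/B) := by field_simp
    rw [hev, hev, hA] at h
    have h' : B*B * ((a + C'/B) * (b + C'/B)) < 0 := by
      calc _ = (B * a + B * (C'/B)) * (B * b + B * (C'/B)) := by ring
        _ = _ := by rw [← hC]; ring
        _ < 0 := h
    have hBB : 0 < B*B := mul_self_pos.2 hB
    have h2 := neg_of_mul_neg_right h' hBB.le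
    refine ⟨-(C'/B), ?_, ?_, ?_⟩
    · by_contra hc
      nlinarith [mul_nonneg (show 0 ≤ a + C'/B by linarith) (show 0 ≤ b + C'/B by linarith)]
    · by_contra hc
      nlinarith [mul_nonneg_of_nonpos_of_nonpos (show a + C'/B ≤ 0 by linarith) (show b + C'/B ≤ 0 by linarith)]
    · rw [hev, hA]; field_simp; ring
  · exfalso
    by_cases hdisc : 0 ≤ discrim A B C'
    · obtain ⟨s, hs⟩ := hsq _ hdisc
      obtain ⟨x, hx⟩ := exists_quadratic_eq_zero hA ⟨s, by rw [← hs]; ring⟩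
      have h1 := degree_eq_one_of_irreducible_of_root hp (x := x) (by rw [IsRoot.def, hev, hx])
      apply hA
      apply coeff_eq_zero_of_degree_lt
      rw [h1]; norm_num
    · have hpos : ∀ x, 0 < A * p.eval x := by
        intro x
        rw [hev]
        rw [discrim] at hdisc
        nlinarith [sq_nonneg (2*A*x + B)]
      have := mul_pos (hpos a) (hpos b)
      have h2 : 0 < A*A := mul_self_pos.2 hA
      nlinarith

theorem ivt_aux (hsq : ∀ x : M, 0 ≤ x → ∃ y : M, y ^ 2 = x)
    (hodd : ∀ P : M[X], Odd P.natDegree → ∃ x : M, P.eval x = 0)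
    (p : M[X]) (a b : M) (hab : a ≤ b) (h : p.eval a * p.eval b < 0) :
    ∃ c, a < c ∧ c < b ∧ p.eval c = 0 := by
  induction p using WfDvdMonoid.induction_on_irreducible with
  | zero => simp at h
  | unit u hu =>
    obtain ⟨r, hr, rfl⟩ := Polynomial.isUnit_iff.1 hu
    simp at h
    nlinarith [mul_self_nonneg r]
  | mul q i hq0 hi ih =>
    by_cases h1 : i.eval a * i.eval b < 0
    · obtain ⟨c, h1, h2, h3⟩ := irred_sign hsq hodd i hi a b hab h1
      exact ⟨c, h1, h2, by rw [eval_mul, h3, zero_mul]⟩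
    · have h2 : q.eval a * q.eval b < 0 := by
        rw [eval_mul, eval_mul] at h
        by_contra h3
        have := mul_nonneg (not_lt.1 h1) (not_lt.1 h3)
        nlinarith
      obtain ⟨c, h1, h2, h3⟩ := ih h2
      exact ⟨c, h1, h2, by rw [eval_mul, h3, mul_zero]⟩

end RCFAux

namespace RCFAux
open Polynomial

def IVT (M : Type*) [Field M] [LinearOrder M] : Prop :=
  ∀ (p : M[X]) (a b : M), a ≤ b → p.eval a * p.eval b < 0 → ∃ c, a < c ∧ c < b ∧ p.eval c = 0

section basics
variable {M : Type*} [Field M] [LinearOrder M] [IsStrictOrderedRing M]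

theorem sign_eq_of_mul_pos {a b : M} (h : 0 < a * b) : SignType.sign a = SignType.sign b := by
  rcases pos_and_pos_or_neg_and_neg_of_mul_pos h with ⟨h1, h2⟩ | ⟨h1, h2⟩
  · rw [sign_pos h1, sign_pos h2]
  · rw [sign_neg h1, sign_neg h2]

theorem sign_no_root (hI : IVT M) (p : M[X]) {a b : M} (hab : a ≤ b)
    (h : ∀ c, a ≤ c → c ≤ b → p.eval c ≠ 0) :
    SignType.sign (p.eval a) = SignType.sign (p.eval b) := by
  apply sign_eq_of_mul_pos
  by_contra hc
  rcases (not_lt.1 hc).lt_or_eq with h1 | h1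
  · obtain ⟨c, h1, h2, h3⟩ := hI p a b hab h1
    exact h c h1.le h2.le h3
  · rcases mul_eq_zero.1 h1 with h1 | h1
    · exact h a le_rfl hab h1
    · exact h b hab le_rfl h1

theorem rolle_aux (hI : IVT M) (p : M[X]) (hp : p ≠ 0) {a b : M} (hab : a < b)
    (ha : p.eval a = 0) (hb : p.eval b = 0) (hno : ∀ c, a < c → c < b → p.eval c ≠ 0) :
    ∃ c, a < c ∧ c < b ∧ p.derivative.eval c = 0 := by
  obtain ⟨q, hq, hqa⟩ := exists_eq_pow_rootMultiplicity_mul_and_not_dvd p hp a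
  have hm : 0 < p.rootMultiplicity a := (rootMultiplicity_pos hp).2 ha
  obtain ⟨m, hm'⟩ : ∃ m, p.rootMultiplicity a = m + 1 := ⟨_, (Nat.succ_pred_eq_of_pos hm).symm⟩
  rw [hm'] at hq
  have hq0 : q ≠ 0 := by rintro rfl; simp at hqa
  have hba : b - a ≠ 0 := sub_ne_zero.2 hab.ne'
  have hqb : q.eval b = 0 := by
    rw [hq] at hb
    simpa [hba] using hb
  obtain ⟨r, hr, hrb⟩ := exists_eq_pow_rootMultiplicity_mul_and_not_dvd q hq0 b
  have hn : 0 < q.rootMultiplicity b := (rootMultiplicity_pos hq0).2 hqb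
  obtain ⟨n, hn'⟩ : ∃ n, q.rootMultiplicity b = n + 1 := ⟨_, (Nat.succ_pred_eq_of_pos hn).symm⟩
  rw [hn'] at hr
  have hra : r.eval a ≠ 0 := by
    intro h
    apply hqa
    rw [dvd_iff_isRoot, IsRoot.def, hr, eval_mul, h, mul_zero]
  have hrb' : r.eval b ≠ 0 := by
    intro h
    exact hrb (dvd_iff_isRoot.2 h)
  have hpe : p = (X - C a)^(m+1) * ((X - C b)^(n+1) * r) := by rw [← hr]; exact hq
  have hrno : ∀ c, a ≤ c → c ≤ b → r.eval c ≠ 0 := by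
    intro c h1 h2 h3
    rcases h1.lt_or_eq with h1 | rfl
    · rcases h2.lt_or_eq with h2 | rfl
      · apply hno c h1 h2
        rw [hpe]; simp [h3]
      · exact hrb' h3
    · exact hra h3
  have hs := sign_no_root hI r hab.le hrno
  have hpos : 0 < r.eval a * r.eval b := by
    rcases lt_or_gt_of_ne hra with h | h
    · rw [sign_neg h] at hs
      exact mul_pos_of_neg_of_neg h (sign_eq_neg_one_iff.1 hs.symm)
    · rw [sign_pos h] at hs
      exact mul_pos h (sign_eq_one_iff.1 hs.symm)
  let w : M[X] := C ((m:M)+1) * (X - C b) * r + C ((n:M)+1) * (X - C a) * r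
    + (X - C a) * (X - C b) * r.derivative
  have hd : p.derivative = (X - C a)^m * (X - C b)^n * w := by
    rw [hpe]
    simp only [derivative_mul, derivative_X_sub_C_pow, w]
    simp
    ring
  obtain ⟨c, h1, h2, h3⟩ := hI w a b hab.le (by
    simp only [w, eval_add, eval_mul, eval_sub, eval_X, eval_C]
    have hmm : (0:M) < (m:M)+1 := by positivity
    have hnn : (0:M) < (n:M)+1 := by positivity
    have : 0 < (b-a)*(b-a) := mul_self_pos.2 hba
    have h5 := mul_pos (mul_pos (mul_pos hmm hnn) this) hpos
    nlinarith)
  exact ⟨c, h1, h2, by rw [hd, eval_mul, h3, mul_zero]⟩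

theorem rolle (hI : IVT M) (p : M[X]) {a b : M} (hab : a < b)
    (ha : p.eval a = 0) (hb : p.eval b = 0) :
    ∃ c, a < c ∧ c < b ∧ p.derivative.eval c = 0 := by
  by_cases hp : p = 0
  · obtain ⟨c, h1, h2⟩ := exists_between hab
    exact ⟨c, h1, h2, by simp [hp]⟩
  let T := p.roots.toFinset.filter (fun z => a < z)
  have hT : T.Nonempty := ⟨b, by simp [T, hp, hb, hab]⟩
  have hmem := T.min'_mem hT
  set b' := T.min' hT
  simp only [T, Finset.mem_filter, Multiset.mem_toFinset, mem_roots hp, IsRoot.def] at hmem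
  have hle : b' ≤ b := T.min'_le _ (by simp [T, hp, hb, hab])
  obtain ⟨c, h1, h2, h3⟩ := rolle_aux hI p hp hmem.2 ha hmem.1 (by
    intro c h1 h2 h3
    exact absurd (T.min'_le c (by simp [T, hp, h3, h1])) (not_le.2 h2))
  exact ⟨c, h1, h2.trans_le hle, h3⟩

theorem mvt (hI : IVT M) (p : M[X]) {a b : M} (hab : a < b) :
    ∃ c, a < c ∧ c < b ∧ p.eval b - p.eval a = p.derivative.eval c * (b - a) := by
  have hba : b - a ≠ 0 := sub_ne_zero.2 hab.ne'
  obtain ⟨c, h1, h2, h3⟩ := rolle hI (p - C ((p.eval b - p.eval a)/(b-a)) * (X - C a) - C (p.eval a)) hab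
    (by simp) (by simp; field_simp; ring)
  refine ⟨c, h1, h2, ?_⟩
  simp at h3
  rw [sub_eq_zero.1 h3]
  field_simp

theorem sign_right (hI : IVT M) (p : M[X]) {a x : M} (hax : a < x) (ha : p.eval a = 0)
    (h : ∀ c, a < c → c ≤ x → p.derivative.eval c ≠ 0) :
    SignType.sign (p.eval x) = SignType.sign (p.derivative.eval x) := by
  obtain ⟨c, h1, h2, h3⟩ := mvt hI p hax
  rw [ha, sub_zero] at h3
  rw [h3, sign_mul, sign_pos (sub_pos.2 hax), mul_one]
  exact sign_no_root hI _ h2.le (fun d hd hd' => h d (h1.trans_le hd) hd')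

theorem sign_left (hI : IVT M) (p : M[X]) {a x : M} (hax : x < a) (ha : p.eval a = 0)
    (h : ∀ c, x ≤ c → c < a → p.derivative.eval c ≠ 0) :
    SignType.sign (p.eval x) = - SignType.sign (p.derivative.eval x) := by
  obtain ⟨c, h1, h2, h3⟩ := mvt hI p hax
  rw [ha, zero_sub] at h3
  have h4 : p.eval x = - (p.derivative.eval c * (a - x)) := by rw [← h3]; ring
  rw [h4, Left.sign_neg, sign_mul, sign_pos (sub_pos.2 hax), mul_one]
  congr 1
  exact (sign_no_root hI _ h1.le (fun d hd hd' => h d hd (hd'.trans_lt h2))).symm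

theorem lc_pos_aux (n : ℕ) : ∀ p : M[X], p.natDegree = n → 0 < p.leadingCoeff →
    ∃ B δ : M, 0 < δ ∧ ∀ x, B ≤ x → δ ≤ p.eval x := by
  induction n with
  | zero =>
    intro p hp hl
    obtain ⟨c, rfl⟩ := natDegree_eq_zero.1 hp
    exact ⟨0, c, by simpa using hl, fun x _ => by simp⟩
  | succ n ih =>
    intro p hp hl
    have h1 : p.divX.natDegree = n := by rw [natDegree_divX_eq_natDegree_tsub_one, hp]; rfl
    have h2 : p.divX.leadingCoeff = p.leadingCoeff := by
      rw [leadingCoeff, leadingCoeff, h1, hp, coeff_divX]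
    obtain ⟨B, δ, hδ, h⟩ := ih p.divX h1 (by rw [h2]; exact hl)
    refine ⟨max (max B 0) ((δ - p.coeff 0)/δ), δ, hδ, fun x hx => ?_⟩
    have hx1 : B ≤ x := (le_max_left _ _).trans ((le_max_left _ _).trans hx)
    have hx2 : 0 ≤ x := (le_max_right _ _).trans ((le_max_left _ _).trans hx)
    have hx3 : (δ - p.coeff 0)/δ ≤ x := (le_max_right _ _).trans hx
    rw [div_le_iff₀ hδ] at hx3
    have h5 := h x hx1
    conv_rhs => rw [← divX_mul_X_add p]
    simp only [eval_add, eval_mul, eval_X, eval_C]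
    nlinarith

theorem sign_top (p : M[X]) (hI : IVT M) (x : M) (h : ∀ c, x ≤ c → p.eval c ≠ 0) :
    SignType.sign (p.eval x) = SignType.sign p.leadingCoeff := by
  have key : ∀ q : M[X], 0 < q.leadingCoeff → (∀ c, x ≤ c → q.eval c ≠ 0) →
      SignType.sign (q.eval x) = 1 := by
    intro q hq hc
    obtain ⟨B, δ, hδ, hB⟩ := lc_pos_aux _ q rfl hq
    rw [sign_no_root hI q (le_max_left x B) (fun c h1 _ => hc c h1)]
    exact sign_pos (hδ.trans_le (hB _ (le_max_right _ _)))
  have hp : p ≠ 0 := by rintro rfl; exact h x le_rfl (by simp)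
  rcases lt_or_gt_of_ne (leadingCoeff_ne_zero.2 hp) with h1 | h1
  · have := key (-p) (by simpa using h1) (fun c hc => by simpa using h c hc)
    rw [eval_neg, Left.sign_neg] at this
    rw [sign_neg h1, ← this, neg_neg]
  · rw [sign_pos h1, key p h1 h]

theorem sign_bot (p : M[X]) (hI : IVT M) (x : M) (h : ∀ c, c ≤ x → p.eval c ≠ 0) :
    SignType.sign (p.eval x) = SignType.sign ((-1)^p.natDegree * p.leadingCoeff) := by
  have := sign_top (p.comp (-X)) hI (-x) (fun c hc => by
    simpa using h (-c) (by linarith))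
  simp only [eval_comp, eval_neg, eval_X, neg_neg] at this
  rw [this]
  rw [leadingCoeff_comp (by simp)]
  simp [mul_comm]

end basics

section corr
variable {M K : Type*} [Field M] [LinearOrder M] [IsStrictOrderedRing M] [Field K]

def Corr (E : Finset (M × M)) (x y : M) : Prop :=
  ∀ u ∈ E, (u.1 < x ↔ u.2 < y) ∧ (x < u.1 ↔ y < u.2)

theorem core_left (hI : IVT M) (f g : K →+* M) (hfg : ∀ k, SignType.sign (f k) = SignType.sign (g k))
    (E : Finset (M × M)) (hmono : ∀ u ∈ E, ∀ v ∈ E, u.1 < v.1 ↔ u.2 < v.2)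
    (x y : M) (hxy : Corr E x y) (q : K[X])
    (hs : ∀ u ∈ E, SignType.sign ((q.map f).eval u.1) = SignType.sign ((q.map g).eval u.2))
    (hf : ∀ z ≤ x, (∀ u ∈ E, u.1 < x → u.1 < z) → (q.map f).eval z ≠ 0)
    (hg : ∀ z ≤ y, (∀ u ∈ E, u.2 < y → u.2 < z) → (q.map g).eval z ≠ 0)
    (hd : SignType.sign ((q.derivative.map f).eval x) = SignType.sign ((q.derivative.map g).eval y))
    (hdf : ∀ z ≤ x, (∀ u ∈ E, u.1 < x → u.1 < z) → (q.derivative.map f).eval z ≠ 0)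
    (hdg : ∀ z ≤ y, (∀ u ∈ E, u.2 < y → u.2 < z) → (q.derivative.map g).eval z ≠ 0) :
    SignType.sign ((q.map f).eval x) = SignType.sign ((q.map g).eval y) := by
  classical
  by_cases hE : (E.filter (fun u => u.1 < x)).Nonempty
  · obtain ⟨u, hu, hmax⟩ := Finset.exists_max_image _ (fun u => u.1) hE
    simp only [Finset.mem_filter] at hu hmax
    have hux := hu.2
    have huy := (hxy u hu.1).1.1 hu.2
    have hz1 : ∀ z, u.1 < z → ∀ v ∈ E, v.1 < x → v.1 < z := fun z hz v hv hvx =>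
      (hmax v ⟨hv, hvx⟩).trans_lt hz
    have hz2 : ∀ z, u.2 < z → ∀ v ∈ E, v.2 < y → v.2 < z := by
      intro z hz v hv hvy
      have h1 := hmax v ⟨hv, (hxy v hv).1.2 hvy⟩
      refine lt_of_le_of_lt ?_ hz
      by_contra hc
      exact absurd ((hmono u hu.1 v hv).2 (not_le.1 hc)) (not_lt.2 h1)
    by_cases h0 : (q.map f).eval u.1 = 0
    · have h0' : (q.map g).eval u.2 = 0 := by
        have := hs u hu.1
        rw [h0, sign_zero] at this
        exact sign_eq_zero_iff.1 this.symm
      rw [sign_right hI _ hux h0, sign_right hI _ huy h0', derivative_map, derivative_map, hd]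
      · intro c h1 h2; rw [derivative_map]; exact hdg c h2 (hz2 c h1)
      · intro c h1 h2; rw [derivative_map]; exact hdf c h2 (hz1 c h1)
    · have h0' : (q.map g).eval u.2 ≠ 0 := by
        intro h
        have := hs u hu.1
        rw [h, sign_zero] at this
        exact h0 (sign_eq_zero_iff.1 this)
      rw [← sign_no_root hI _ hux.le, ← sign_no_root hI _ huy.le, hs u hu.1]
      · intro c h1 h2
        rcases h1.lt_or_eq with h1 | rfl
        · exact hg c h2 (hz2 c h1)
        · exact h0'
      · intro c h1 h2
        rcases h1.lt_or_eq with h1 | rfl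
        · exact hf c h2 (hz1 c h1)
        · exact h0
  · have h1 : ∀ u ∈ E, ¬ u.1 < x := fun u hu h => hE ⟨u, by simp [hu, h]⟩
    have h2 : ∀ u ∈ E, ¬ u.2 < y := fun u hu h => h1 u hu ((hxy u hu).1.2 h)
    rw [sign_bot _ hI, sign_bot _ hI]
    · simp only [natDegree_map, leadingCoeff_map, sign_mul, hfg]
    · intro c hc; exact hg c hc (fun u hu h => absurd h (h2 u hu))
    · intro c hc; exact hf c hc (fun u hu h => absurd h (h1 u hu))

theorem core_right (hI : IVT M) (f g : K →+* M) (hfg : ∀ k, SignType.sign (f k) = SignType.sign (g k))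
    (E : Finset (M × M)) (hmono : ∀ u ∈ E, ∀ v ∈ E, u.1 < v.1 ↔ u.2 < v.2)
    (x y : M) (hxy : Corr E x y) (q : K[X])
    (hs : ∀ u ∈ E, SignType.sign ((q.map f).eval u.1) = SignType.sign ((q.map g).eval u.2))
    (hf : ∀ z, x ≤ z → (∀ u ∈ E, x < u.1 → z < u.1) → (q.map f).eval z ≠ 0)
    (hg : ∀ z, y ≤ z → (∀ u ∈ E, y < u.2 → z < u.2) → (q.map g).eval z ≠ 0)
    (hd : SignType.sign ((q.derivative.map f).eval x) = SignType.sign ((q.derivative.map g).eval y))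
    (hdf : ∀ z, x ≤ z → (∀ u ∈ E, x < u.1 → z < u.1) → (q.derivative.map f).eval z ≠ 0)
    (hdg : ∀ z, y ≤ z → (∀ u ∈ E, y < u.2 → z < u.2) → (q.derivative.map g).eval z ≠ 0) :
    SignType.sign ((q.map f).eval x) = SignType.sign ((q.map g).eval y) := by
  classical
  by_cases hE : (E.filter (fun u => x < u.1)).Nonempty
  · obtain ⟨u, hu, hmin⟩ := Finset.exists_min_image _ (fun u => u.1) hE
    simp only [Finset.mem_filter] at hu hmin
    have hux := hu.2
    have huy := (hxy u hu.1).2.1 hu.2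
    have hz1 : ∀ z, z < u.1 → ∀ v ∈ E, x < v.1 → z < v.1 := fun z hz v hv hvx =>
      hz.trans_le (hmin v ⟨hv, hvx⟩)
    have hz2 : ∀ z, z < u.2 → ∀ v ∈ E, y < v.2 → z < v.2 := by
      intro z hz v hv hvy
      have h1 := hmin v ⟨hv, (hxy v hv).2.2 hvy⟩
      refine lt_of_lt_of_le hz ?_
      by_contra hc
      exact absurd ((hmono v hv u hu.1).2 (not_le.1 hc)) (not_lt.2 h1)
    by_cases h0 : (q.map f).eval u.1 = 0
    · have h0' : (q.map g).eval u.2 = 0 := by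
        have := hs u hu.1
        rw [h0, sign_zero] at this
        exact sign_eq_zero_iff.1 this.symm
      rw [sign_left hI _ hux h0, sign_left hI _ huy h0', derivative_map, derivative_map, hd]
      · intro c h1 h2; rw [derivative_map]; exact hdg c h1 (hz2 c h2)
      · intro c h1 h2; rw [derivative_map]; exact hdf c h1 (hz1 c h2)
    · have h0' : (q.map g).eval u.2 ≠ 0 := by
        intro h
        have := hs u hu.1
        rw [h, sign_zero] at this
        exact h0 (sign_eq_zero_iff.1 this)
      rw [sign_no_root hI _ hux.le, sign_no_root hI _ huy.le, hs u hu.1]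
      · intro c h1 h2
        rcases h2.lt_or_eq with h2 | rfl
        · exact hg c h1 (hz2 c h2)
        · exact h0'
      · intro c h1 h2
        rcases h2.lt_or_eq with h2 | rfl
        · exact hf c h1 (hz1 c h2)
        · exact h0
  · have h1 : ∀ u ∈ E, ¬ x < u.1 := fun u hu h => hE ⟨u, by simp [hu, h]⟩
    have h2 : ∀ u ∈ E, ¬ y < u.2 := fun u hu h => h1 u hu ((hxy u hu).2.2 h)
    rw [sign_top _ hI, sign_top _ hI]
    · simp only [leadingCoeff_map, hfg]
    · intro c hc; exact hg c hc (fun u hu h => absurd h (h2 u hu))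
    · intro c hc; exact hf c hc (fun u hu h => absurd h (h1 u hu))

end corr
end RCFAux

namespace RCFAux
open Polynomial

section diag
variable {M K : Type*} [Field M] [LinearOrder M] [IsStrictOrderedRing M] [Field K]

structure Good (f g : K →+* M) (s : Finset K[X]) (E : Finset (M × M)) : Prop where
  mono : ∀ u ∈ E, ∀ v ∈ E, u.1 < v.1 ↔ u.2 < v.2
  root : ∀ u ∈ E, ∃ q ∈ s, (q.map f).eval u.1 = 0
  cov1 : ∀ q ∈ s, ∀ x, (q.map f).eval x = 0 → ∃ u ∈ E, u.1 = x
  cov2 : ∀ q ∈ s, ∀ x, (q.map g).eval x = 0 → ∃ u ∈ E, u.2 = x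
  sgn : ∀ u ∈ E, ∀ q ∈ s,
    SignType.sign ((q.map f).eval u.1) = SignType.sign ((q.map g).eval u.2)

theorem exists_corr (E : Finset (M × M)) (hmono : ∀ u ∈ E, ∀ v ∈ E, u.1 < v.1 ↔ u.2 < v.2)
    (x : M) : ∃ y, Corr E x y := by
  classical
  by_cases hx : ∃ u ∈ E, u.1 = x
  · obtain ⟨u, hu, rfl⟩ := hx
    exact ⟨u.2, fun v hv => ⟨hmono v hv u hu, hmono u hu v hv⟩⟩
  · push Not at hx
    obtain ⟨y, h1, h2⟩ := Order.exists_between_finsets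
      ((E.filter (fun u => u.1 < x)).image Prod.snd) ((E.filter (fun u => x < u.1)).image Prod.snd)
      (by
        intro a ha b hb
        simp only [Finset.mem_image, Finset.mem_filter] at ha hb
        obtain ⟨u, ⟨hu, hux⟩, rfl⟩ := ha
        obtain ⟨v, ⟨hv, hvx⟩, rfl⟩ := hb
        exact (hmono u hu v hv).1 (hux.trans hvx))
    refine ⟨y, fun u hu => ?_⟩
    rcases lt_or_gt_of_ne (hx u hu) with h | h
    · have h3 := h1 u.2 (Finset.mem_image.2 ⟨u, by simp [hu, h], rfl⟩)
      exact ⟨iff_of_true h h3, iff_of_false (lt_asymm h) (lt_asymm h3)⟩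
    · have h3 := h2 u.2 (Finset.mem_image.2 ⟨u, by simp [hu, h], rfl⟩)
      exact ⟨iff_of_false (lt_asymm h) (lt_asymm h3), iff_of_true h h3⟩

theorem Corr.swap {E : Finset (M × M)} {x y : M} (h : Corr E x y) :
    Corr (E.map (Equiv.prodComm M M).toEmbedding) y x := by
  intro u hu
  simp only [Finset.mem_map_equiv] at hu
  have := h _ hu
  exact ⟨this.1.symm, this.2.symm⟩

theorem Corr.of_swap {E : Finset (M × M)} {x y : M}
    (h : Corr (E.map (Equiv.prodComm M M).toEmbedding) y x) : Corr E x y := by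
  intro u hu
  have := h (u.2, u.1) (by simpa using hu)
  exact ⟨this.1.symm, this.2.symm⟩

theorem Good.swap {f g : K →+* M} {s : Finset K[X]} {E : Finset (M × M)} (h : Good f g s E) :
    Good g f s (E.map (Equiv.prodComm M M).toEmbedding) where
  mono u hu v hv := by
    simp only [Finset.mem_map_equiv] at hu hv
    exact (h.mono _ hu _ hv).symm
  root u hu := by
    simp only [Finset.mem_map_equiv] at hu
    obtain ⟨q, hq, hq0⟩ := h.root _ hu
    refine ⟨q, hq, ?_⟩
    have := h.sgn _ hu q hq
    rw [hq0, sign_zero] at this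
    exact sign_eq_zero_iff.1 this.symm
  cov1 q hq x hx := by
    obtain ⟨u, hu, rfl⟩ := h.cov2 q hq x hx
    exact ⟨(u.2, u.1), by simpa using hu, rfl⟩
  cov2 q hq x hx := by
    obtain ⟨u, hu, rfl⟩ := h.cov1 q hq x hx
    exact ⟨(u.2, u.1), by simpa using hu, rfl⟩
  sgn u hu q hq := by
    simp only [Finset.mem_map_equiv] at hu
    exact (h.sgn _ hu q hq).symm

theorem corr_eq {E : Finset (M × M)} {x y : M} (h : Corr E x y) {u : M × M} (hu : u ∈ E) :
    u.1 = x ↔ u.2 = y := by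
  have := h u hu
  constructor
  · intro h1
    apply le_antisymm
    · exact not_lt.1 (fun h2 => (this.2.2 h2).ne' h1)
    · exact not_lt.1 (fun h2 => (this.1.2 h2).ne h1)
  · intro h1
    apply le_antisymm
    · exact not_lt.1 (fun h2 => (this.2.1 h2).ne' h1)
    · exact not_lt.1 (fun h2 => (this.1.1 h2).ne h1)

theorem gap_sign (hI : IVT M) {f g : K →+* M}
    (hfg : ∀ k, SignType.sign (f k) = SignType.sign (g k))
    {s : Finset K[X]} {E : Finset (M × M)} (h : Good f g s E)
    (hsd : ∀ q ∈ s, q.derivative ∈ s ∨ q.derivative = 0)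
    {x y : M} (hxy : Corr E x y) : ∀ (n : ℕ) (q : K[X]), q ∈ s → q.natDegree = n →
    SignType.sign ((q.map f).eval x) = SignType.sign ((q.map g).eval y) := by
  have : CharZero K := f.charZero
  by_cases hx : ∃ u ∈ E, u.1 = x
  · obtain ⟨u, hu, hux⟩ := hx
    intro n q hq _
    rw [← hux, ← (corr_eq hxy hu).1 hux]
    exact h.sgn u hu q hq
  push Not at hx
  have hy : ∀ u ∈ E, u.2 ≠ y := fun u hu hh => hx u hu ((corr_eq hxy hu).2 hh)
  have hf : ∀ q ∈ s, ∀ z ≤ x, (∀ u ∈ E, u.1 < x → u.1 < z) → (q.map f).eval z ≠ 0 := by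
    intro q hq z hz hu h0
    obtain ⟨u, huE, rfl⟩ := h.cov1 q hq z h0
    exact lt_irrefl _ (hu u huE (lt_of_le_of_ne hz (hx u huE)))
  have hg : ∀ q ∈ s, ∀ z ≤ y, (∀ u ∈ E, u.2 < y → u.2 < z) → (q.map g).eval z ≠ 0 := by
    intro q hq z hz hu h0
    obtain ⟨u, huE, rfl⟩ := h.cov2 q hq z h0
    exact lt_irrefl _ (hu u huE (lt_of_le_of_ne hz (hy u huE)))
  intro n
  induction n using Nat.strong_induction_on with
  | _ n ih =>
    intro q hq hn
    by_cases hd0 : q.derivative = 0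
    · obtain ⟨c, rfl⟩ := natDegree_eq_zero.1 (natDegree_eq_zero_of_derivative_eq_zero hd0)
      simpa using hfg c
    have hd : q.derivative ∈ s := (hsd q hq).resolve_right hd0
    have hlt : q.derivative.natDegree < n := by
      rw [← hn]
      apply natDegree_derivative_lt
      intro h0
      obtain ⟨c, rfl⟩ := natDegree_eq_zero.1 h0
      simp at hd0
    exact core_left hI f g hfg E h.mono x y hxy q (fun u hu => h.sgn u hu q hq)
      (hf q hq) (hg q hq) (ih _ hlt _ hd rfl) (hf _ hd) (hg _ hd)

/-- a root of the new polynomial on one side has a partner on the other side -/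
theorem step_cov (hI : IVT M) {f g : K →+* M}
    (hfg : ∀ k, SignType.sign (f k) = SignType.sign (g k))
    {s : Finset K[X]} {E : Finset (M × M)} (h : Good f g s E)
    (hsd : ∀ q ∈ s, q.derivative ∈ s ∨ q.derivative = 0)
    (p : K[X]) (hp : p ≠ 0) (hpd : p.derivative ∈ s ∨ p.derivative = 0)
    (hps : ∀ u ∈ E, SignType.sign ((p.map f).eval u.1) = SignType.sign ((p.map g).eval u.2))
    (x : M) (hx0 : (p.map f).eval x = 0) :
    (∃ y, (p.map g).eval y = 0 ∧ Corr E x y) := by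
  classical
  have : CharZero K := f.charZero
  by_cases hx : ∃ u ∈ E, u.1 = x
  · obtain ⟨u, hu, rfl⟩ := hx
    refine ⟨u.2, ?_, fun v hv => ⟨h.mono v hv u hu, h.mono u hu v hv⟩⟩
    have := hps u hu
    rw [hx0, sign_zero] at this
    exact sign_eq_zero_iff.1 this.symm
  push Not at hx
  have hpd' : p.derivative ∈ s := by
    refine hpd.resolve_right (fun h0 => ?_)
    obtain ⟨c, rfl⟩ := natDegree_eq_zero.1 (natDegree_eq_zero_of_derivative_eq_zero h0)
    simp at hx0
    simp [hx0] at hp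
  by_contra hcon
  push Not at hcon
  obtain ⟨y, hy⟩ := exists_corr E h.mono x
  have hyne : ∀ u ∈ E, u.2 ≠ y := fun u hu hh => hx u hu ((corr_eq hy hu).2 hh)
  obtain ⟨x1, hx1, hx1'⟩ := Order.exists_between_finsets
      ((E.filter (fun u => u.1 < x)).image Prod.fst) {x} (by
        intro a ha b hb
        simp only [Finset.mem_image, Finset.mem_filter, Finset.mem_singleton] at ha hb
        obtain ⟨u, ⟨hu, hux⟩, rfl⟩ := ha
        rw [hb]; exact hux)
  obtain ⟨x2, hx2', hx2⟩ := Order.exists_between_finsets {x}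
      ((E.filter (fun u => x < u.1)).image Prod.fst) (by
        intro b hb a ha
        simp only [Finset.mem_image, Finset.mem_filter, Finset.mem_singleton] at ha hb
        obtain ⟨u, ⟨hu, hux⟩, rfl⟩ := ha
        rw [hb]; exact hux)
  replace hx1 : ∀ u ∈ E, u.1 < x → u.1 < x1 := fun u hu hux =>
    hx1 u.1 (Finset.mem_image.2 ⟨u, by simp [hu, hux], rfl⟩)
  replace hx2 : ∀ u ∈ E, x < u.1 → x2 < u.1 := fun u hu hux =>
    hx2 u.1 (Finset.mem_image.2 ⟨u, by simp [hu, hux], rfl⟩)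
  replace hx1' : x1 < x := hx1' x (by simp)
  replace hx2' : x < x2 := hx2' x (by simp)
  have hc1 : Corr E x1 y := by
    intro u hu
    have h1 := hy u hu
    rcases lt_or_gt_of_ne (hx u hu) with h2 | h2
    · have h3 := hx1 u hu h2
      exact ⟨iff_of_true h3 (h1.1.1 h2), iff_of_false (lt_asymm h3) (lt_asymm (h1.1.1 h2))⟩
    · have h3 := hx1'.trans h2
      exact ⟨iff_of_false (lt_asymm h3) (lt_asymm (h1.2.1 h2)), iff_of_true h3 (h1.2.1 h2)⟩
  have hc2 : Corr E x2 y := by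
    intro u hu
    have h1 := hy u hu
    rcases lt_or_gt_of_ne (hx u hu) with h2 | h2
    · have h3 := h2.trans hx2'
      exact ⟨iff_of_true h3 (h1.1.1 h2), iff_of_false (lt_asymm h3) (lt_asymm (h1.1.1 h2))⟩
    · have h3 := hx2 u hu h2
      exact ⟨iff_of_false (lt_asymm h3) (lt_asymm (h1.2.1 h2)), iff_of_true h3 (h1.2.1 h2)⟩
  -- no root of the derivative in the gap
  have hdf : ∀ z, (∀ u ∈ E, u.1 ≠ z) → (p.derivative.map f).eval z ≠ 0 := by
    intro z hz h0
    obtain ⟨u, hu, rfl⟩ := h.cov1 _ hpd' z h0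
    exact hz u hu rfl
  have hdg : ∀ z, (∀ u ∈ E, u.2 ≠ z) → (p.derivative.map g).eval z ≠ 0 := by
    intro z hz h0
    obtain ⟨u, hu, rfl⟩ := h.cov2 _ hpd' z h0
    exact hz u hu rfl
  have hgap : ∀ z, (∀ u ∈ E, u.1 < x → u.1 < z) → (∀ u ∈ E, x < u.1 → z < u.1) →
      ∀ u ∈ E, u.1 ≠ z := by
    intro z h1 h2 u hu hz
    rcases lt_or_gt_of_ne (hx u hu) with h3 | h3
    · exact (h1 u hu h3).ne hz
    · exact (h2 u hu h3).ne' hz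
  have hgap2 : ∀ z, (∀ u ∈ E, u.2 < y → u.2 < z) → (∀ u ∈ E, y < u.2 → z < u.2) →
      ∀ u ∈ E, u.2 ≠ z := by
    intro z h1 h2 u hu hz
    rcases lt_or_gt_of_ne (hyne u hu) with h3 | h3
    · exact (h1 u hu h3).ne hz
    · exact (h2 u hu h3).ne' hz
  -- other roots of p
  have hroot : ∀ z, z ≠ x → (∀ u ∈ E, u.1 < x → u.1 < z) → (∀ u ∈ E, x < u.1 → z < u.1) →
      (p.map f).eval z ≠ 0 := by
    intro z hz h1 h2 h0
    rcases lt_or_gt_of_ne hz with h3 | h3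
    · obtain ⟨c, hc1, hc2, hc3⟩ := rolle hI _ h3 h0 hx0
      rw [derivative_map] at hc3
      exact hdf c (hgap c (fun u hu hux => (h1 u hu hux).trans hc1)
        (fun u hu hux => hc2.trans hux)) hc3
    · obtain ⟨c, hc1, hc2, hc3⟩ := rolle hI _ h3 hx0 h0
      rw [derivative_map] at hc3
      exact hdf c (hgap c (fun u hu hux => hux.trans hc1)
        (fun u hu hux => hc2.trans (h2 u hu hux))) hc3
  have hgroot : ∀ z, (∀ u ∈ E, u.2 < y → u.2 < z) → (∀ u ∈ E, y < u.2 → z < u.2) →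
      (p.map g).eval z ≠ 0 := by
    intro z h1 h2 h0
    refine hcon z h0 (fun u hu => ?_)
    have h4 := hy u hu
    rcases lt_or_gt_of_ne (hx u hu) with h3 | h3
    · have h5 := h1 u hu (h4.1.1 h3)
      exact ⟨iff_of_true h3 h5, iff_of_false (lt_asymm h3) (lt_asymm h5)⟩
    · have h5 := h2 u hu (h4.2.1 h3)
      exact ⟨iff_of_false (lt_asymm h3) (lt_asymm h5), iff_of_true h3 h5⟩
  have hx1lt : ∀ u ∈ E, u.1 < x1 ↔ u.1 < x := fun u hu => ⟨fun h => h.trans hx1', hx1 u hu⟩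
  have hx2lt : ∀ u ∈ E, x2 < u.1 ↔ x < u.1 := fun u hu => ⟨fun h => hx2'.trans h, hx2 u hu⟩
  have e1 : SignType.sign ((p.map f).eval x1) = SignType.sign ((p.map g).eval y) := by
    have q1 : ∀ z ≤ x1, (∀ u ∈ E, u.1 < x1 → u.1 < z) →
        (∀ u ∈ E, u.1 < x → u.1 < z) ∧ (∀ u ∈ E, x < u.1 → z < u.1) := fun z hz hz' =>
      ⟨fun u hu hux => hz' u hu ((hx1lt u hu).2 hux),
        fun u hu hux => (hz.trans_lt hx1').trans hux⟩
    apply core_left hI f g hfg E h.mono x1 y hc1 p hps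
    · intro z hz hz'
      exact hroot z (hz.trans_lt hx1').ne (q1 z hz hz').1 (q1 z hz hz').2
    · intro z hz hz'
      exact hgroot z hz' (fun u hu hux => hz.trans_lt hux)
    · exact gap_sign hI hfg h hsd hc1 _ _ hpd' rfl
    · intro z hz hz'
      exact hdf z (hgap z (q1 z hz hz').1 (q1 z hz hz').2)
    · intro z hz hz'
      exact hdg z (hgap2 z hz' (fun u hu hux => hz.trans_lt hux))
  have e2 : SignType.sign ((p.map f).eval x2) = SignType.sign ((p.map g).eval y) := by
    have q2 : ∀ z, x2 ≤ z → (∀ u ∈ E, x2 < u.1 → z < u.1) →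
        (∀ u ∈ E, u.1 < x → u.1 < z) ∧ (∀ u ∈ E, x < u.1 → z < u.1) := fun z hz hz' =>
      ⟨fun u hu hux => hux.trans (hx2'.trans_le hz),
        fun u hu hux => hz' u hu ((hx2lt u hu).2 hux)⟩
    apply core_right hI f g hfg E h.mono x2 y hc2 p hps
    · intro z hz hz'
      exact hroot z (hx2'.trans_le hz).ne' (q2 z hz hz').1 (q2 z hz hz').2
    · intro z hz hz'
      exact hgroot z (fun u hu hux => hux.trans_le hz) hz'
    · exact gap_sign hI hfg h hsd hc2 _ _ hpd' rfl
    · intro z hz hz'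
      exact hdf z (hgap z (q2 z hz hz').1 (q2 z hz hz').2)
    · intro z hz hz'
      exact hdg z (hgap2 z (fun u hu hux => hux.trans_le hz) hz')
  have hdall : ∀ c, x1 ≤ c → c ≤ x2 → (p.derivative.map f).eval c ≠ 0 := fun c h1 h2 =>
    hdf c (hgap c (fun u hu hux => (hx1 u hu hux).trans_le h1)
      (fun u hu hux => h2.trans_lt (hx2 u hu hux)))
  have e3 := sign_left hI _ hx1' hx0 (by
    intro c h1 h2; rw [derivative_map]; exact hdall c h1 (h2.trans hx2').le)
  have e4 := sign_right hI _ hx2' hx0 (by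
    intro c h1 h2; rw [derivative_map]; exact hdall c (hx1'.trans h1).le h2)
  rw [derivative_map] at e3 e4
  have e5 := sign_no_root hI _ (hx1'.trans hx2').le hdall
  rw [e1, ← e2, e4, e5] at e3
  have h6 : SignType.sign ((p.derivative.map f).eval x2) = 0 := by
    revert e3
    generalize SignType.sign ((p.derivative.map f).eval x2) = t
    revert t; decide
  exact hdall x2 (hx1'.trans hx2').le le_rfl (sign_eq_zero_iff.1 h6)

theorem step (hI : IVT M) {f g : K →+* M}
    (hfg : ∀ k, SignType.sign (f k) = SignType.sign (g k))
    [DecidableEq K[X]] {s : Finset K[X]} {E : Finset (M × M)} (h : Good f g s E)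
    (hsd : ∀ q ∈ s, q.derivative ∈ s ∨ q.derivative = 0)
    (p : K[X]) (hp : p ≠ 0) (hpd : p.derivative ∈ s ∨ p.derivative = 0)
    (hpm : ∀ q ∈ s, p % q ∈ s ∨ p % q = 0) :
    ∃ E', Good f g (insert p s) E' := by
  classical
  have : CharZero K := f.charZero
  have hps : ∀ u ∈ E, SignType.sign ((p.map f).eval u.1) = SignType.sign ((p.map g).eval u.2) := by
    intro u hu
    obtain ⟨q, hq, hq0⟩ := h.root u hu
    have hq0' : (q.map g).eval u.2 = 0 := by
      have := h.sgn u hu q hq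
      rw [hq0, sign_zero] at this
      exact sign_eq_zero_iff.1 this.symm
    have h1 : ∀ (φ : K →+* M) (z : M), (q.map φ).eval z = 0 →
        (p.map φ).eval z = ((p % q).map φ).eval z := by
      intro φ z hz
      conv_lhs => rw [← EuclideanDomain.div_add_mod p q]
      simp [hz]
    rw [h1 f _ hq0, h1 g _ hq0']
    rcases hpm q hq with h2 | h2
    · exact h.sgn u hu _ h2
    · simp [h2]
  have hmf : p.map f ≠ 0 := by simpa [Polynomial.map_eq_zero] using hp
  have hmg : p.map g ≠ 0 := by simpa [Polynomial.map_eq_zero] using hp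
  let N := ((p.map f).roots.toFinset ×ˢ (p.map g).roots.toFinset).filter (fun u => Corr E u.1 u.2)
  have hN : ∀ u, u ∈ N ↔ ((p.map f).eval u.1 = 0 ∧ (p.map g).eval u.2 = 0) ∧ Corr E u.1 u.2 := by
    intro u
    simp only [N, Finset.mem_filter, Finset.mem_product, Multiset.mem_toFinset, mem_roots hmf,
      mem_roots hmg, IsRoot.def]
  have hpd' : ∀ z, (p.map f).eval z = 0 → p.derivative ∈ s := by
    intro z hz
    refine hpd.resolve_right (fun h0 => ?_)
    obtain ⟨c, rfl⟩ := natDegree_eq_zero.1 (natDegree_eq_zero_of_derivative_eq_zero h0)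
    simp at hz
    simp [hz] at hp
  refine ⟨E ∪ N, ?_, ?_, ?_, ?_, ?_⟩
  · intro u hu v hv
    rw [Finset.mem_union] at hu hv
    rcases hu with hu | hu
    · rcases hv with hv | hv
      · exact h.mono u hu v hv
      · exact (((hN v).1 hv).2 u hu).1
    · rcases hv with hv | hv
      · exact (((hN u).1 hu).2 v hv).2
      · obtain ⟨⟨hu1, hu2⟩, hu3⟩ := (hN u).1 hu
        obtain ⟨⟨hv1, hv2⟩, hv3⟩ := (hN v).1 hv
        constructor
        · intro hlt
          obtain ⟨c, h1, h2, h3⟩ := rolle hI _ hlt hu1 hv1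
          rw [derivative_map] at h3
          obtain ⟨w, hw, rfl⟩ := h.cov1 _ (hpd' _ hu1) c h3
          exact ((hu3 w hw).2.1 h1).trans ((hv3 w hw).1.1 h2)
        · intro hlt
          obtain ⟨c, h1, h2, h3⟩ := rolle hI _ hlt hu2 hv2
          rw [derivative_map] at h3
          obtain ⟨w, hw, rfl⟩ := h.cov2 _ (hpd' _ hu1) c h3
          exact ((hu3 w hw).2.2 h1).trans ((hv3 w hw).1.2 h2)
  · intro u hu
    rcases Finset.mem_union.1 hu with hu | hu
    · obtain ⟨q, hq, hq0⟩ := h.root u hu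
      exact ⟨q, Finset.mem_insert_of_mem hq, hq0⟩
    · exact ⟨p, Finset.mem_insert_self _ _, ((hN u).1 hu).1.1⟩
  · intro q hq x hx
    rcases Finset.mem_insert.1 hq with rfl | hq
    · obtain ⟨y, hy, hc⟩ := step_cov hI hfg h hsd q hp hpd hps x hx
      exact ⟨(x, y), Finset.mem_union_right _ ((hN _).2 ⟨⟨hx, hy⟩, hc⟩), rfl⟩
    · obtain ⟨u, hu, hux⟩ := h.cov1 q hq x hx
      exact ⟨u, Finset.mem_union_left _ hu, hux⟩
  · intro q hq x hx
    rcases Finset.mem_insert.1 hq with rfl | hq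
    · obtain ⟨y, hy, hc⟩ := step_cov hI (fun k => (hfg k).symm) h.swap hsd q hp hpd (by
        intro u hu
        simp only [Finset.mem_map_equiv] at hu
        exact (hps _ hu).symm) x hx
      exact ⟨(y, x), Finset.mem_union_right _ ((hN _).2 ⟨⟨hy, hx⟩, hc.of_swap⟩), rfl⟩
    · obtain ⟨u, hu, hux⟩ := h.cov2 q hq x hx
      exact ⟨u, Finset.mem_union_left _ hu, hux⟩
  · intro u hu q hq
    rcases Finset.mem_union.1 hu with hu' | hu'
    · rcases Finset.mem_insert.1 hq with rfl | hq
      · exact hps u hu'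
      · exact h.sgn u hu' q hq
    · obtain ⟨⟨hu1, hu2⟩, hu3⟩ := (hN u).1 hu'
      rcases Finset.mem_insert.1 hq with rfl | hq
      · rw [hu1, hu2]
      · exact gap_sign hI hfg h hsd hu3 _ q hq rfl

def Closed (s : Finset K[X]) : Prop :=
  ∀ p ∈ s, p ≠ 0 ∧ (p.derivative ∈ s ∨ p.derivative = 0) ∧ ∀ q ∈ s, (p % q ∈ s ∨ p % q = 0)

theorem good_of_closed (hI : IVT M) {f g : K →+* M}
    (hfg : ∀ k, SignType.sign (f k) = SignType.sign (g k)) (s : Finset K[X]) :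
    Closed s → ∃ E, Good f g s E := by
  classical
  refine Finset.induction_on_max_value (fun p : K[X] => p.degree)
    (motive := fun s => Closed s → ∃ E, Good f g s E) s ?_ ?_
  · intro _
    exact ⟨∅, by simp, by simp, by simp, by simp, by simp⟩
  · intro a s has hmax ih hcl
    have hlt : ∀ r : K[X], r.degree < a.degree → (r ∈ insert a s ∨ r = 0) → (r ∈ s ∨ r = 0) := by
      intro r hr h
      rcases h with h | h
      · rcases Finset.mem_insert.1 h with rfl | h
        · exact absurd hr (lt_irrefl _)
        · exact Or.inl h
      · exact Or.inr h
    have hs : Closed s := by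
      intro p hp
      obtain ⟨h1, h2, h3⟩ := hcl p (Finset.mem_insert_of_mem hp)
      refine ⟨h1, hlt _ ((degree_derivative_lt h1).trans_le (hmax p hp)) h2, fun q hq => ?_⟩
      have hq0 := (hcl q (Finset.mem_insert_of_mem hq)).1
      exact hlt _ ((degree_mod_lt p hq0).trans_le (hmax q hq)) (h3 q (Finset.mem_insert_of_mem hq))
    obtain ⟨E, hE⟩ := ih hs
    obtain ⟨h1, h2, h3⟩ := hcl a (Finset.mem_insert_self _ _)
    refine step hI hfg hE (fun q hq => (hs q hq).2.1) a h1
      (hlt _ (degree_derivative_lt h1) h2) (fun q hq => ?_)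
    have hq0 := (hcl q (Finset.mem_insert_of_mem hq)).1
    exact hlt _ ((degree_mod_lt a hq0).trans_le (hmax q hq)) (h3 q (Finset.mem_insert_of_mem hq))

theorem exists_closed_aux (s : Finset K[X]) (d : ℕ) (hd : ∀ p ∈ s, p.degree < d) (j : ℕ) (hj : j ≤ d) :
    ∃ t : Finset K[X], s ⊆ t ∧ ∀ p ∈ t, ((d - j : ℕ) : WithBot ℕ) ≤ p.degree →
      (p.derivative ∈ t ∧ ∀ q ∈ t, ((d - j : ℕ) : WithBot ℕ) ≤ q.degree → p % q ∈ t) := by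
  classical
  induction j with
  | zero =>
    refine ⟨s, subset_rfl, fun p hp h => absurd (hd p hp) (not_lt.2 (by simpa using h))⟩
  | succ j ih =>
    obtain ⟨t, hst, ht⟩ := ih (by omega)
    obtain ⟨k, hk⟩ : ∃ k, d - (j+1) = k := ⟨_, rfl⟩
    have hk' : d - j = k + 1 := by omega
    rw [hk'] at ht
    rw [hk]
    have hge : ∀ p : K[X], (k : WithBot ℕ) ≤ p.degree → p.degree = k ∨ ((k+1 : ℕ) : WithBot ℕ) ≤ p.degree := by
      intro p hp
      have hp0 : p ≠ 0 := by rintro rfl; simp at hp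
      rw [degree_eq_natDegree hp0] at hp ⊢
      norm_cast at hp ⊢
      omega
    let t' := t ∪ t.image derivative ∪ (t ×ˢ t).image (fun u => u.1 % u.2)
    have hdich : ∀ p : K[X], p.degree ≤ k ∨ ((k+1 : ℕ) : WithBot ℕ) ≤ p.degree := by
      intro p
      by_cases hp0 : p = 0
      · subst hp0; simp
      rw [degree_eq_natDegree hp0]
      norm_cast
      omega
    have hmem : ∀ p ∈ t', (k : WithBot ℕ) ≤ p.degree → p ∈ t := by
      intro p hp hpk
      rcases Finset.mem_union.1 hp with hp | hp
      · rcases Finset.mem_union.1 hp with hp | hp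
        · exact hp
        · obtain ⟨q, hq, rfl⟩ := Finset.mem_image.1 hp
          rcases hdich q with h | h
          · by_cases hq0 : q = 0
            · subst hq0; simp at hpk
            · exact absurd hpk (not_le.2 ((degree_derivative_lt hq0).trans_le h))
          · exact (ht q hq h).1
      · obtain ⟨⟨a, b⟩, hab, rfl⟩ := Finset.mem_image.1 hp
        obtain ⟨ha, hb⟩ := Finset.mem_product.1 hab
        simp only at ha hb hpk ⊢
        by_cases hb0 : b = 0
        · subst hb0; simpa using ha
        rcases hdich b with h | h
        · exact absurd hpk (not_le.2 ((degree_mod_lt a hb0).trans_le h))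
        rcases hdich a with h' | h'
        · rw [(Polynomial.mod_eq_self_iff hb0).2]
          · exact ha
          · refine h'.trans_lt (lt_of_lt_of_le ?_ h)
            norm_cast
            omega
        · exact (ht a ha h').2 b hb h
    refine ⟨t', fun p hp => ?_, fun p hp hpk => ⟨?_, fun q hq hqk => ?_⟩⟩
    · exact Finset.mem_union_left _ (Finset.mem_union_left _ (hst hp))
    · exact Finset.mem_union_left _ (Finset.mem_union_right _
        (Finset.mem_image_of_mem _ (hmem p hp hpk)))
    · exact Finset.mem_union_right _ (Finset.mem_image.2 ⟨(p, q),
        Finset.mem_product.2 ⟨hmem p hp hpk, hmem q hq hqk⟩, rfl⟩)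

theorem exists_closed (s : Finset K[X]) :
    ∃ t : Finset K[X], Closed t ∧ ∀ p ∈ s, p ≠ 0 → p ∈ t := by
  classical
  obtain ⟨t, hst, ht⟩ := exists_closed_aux s (s.sup natDegree + 1) (fun p hp => by
    by_cases hp0 : p = 0
    · subst hp0; simp [WithBot.bot_lt_coe]
    rw [degree_eq_natDegree hp0]
    have := Finset.le_sup (f := natDegree) hp
    exact_mod_cast Nat.lt_succ_of_le this) _ le_rfl
  have h0 : ∀ p : K[X], p ≠ 0 →
      ((s.sup natDegree + 1 - (s.sup natDegree + 1) : ℕ) : WithBot ℕ) ≤ p.degree := by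
    intro p hp
    rw [Nat.sub_self]
    exact zero_le_degree_iff.2 hp
  refine ⟨t.erase 0, fun p hp => ?_, fun p hp hp0 => Finset.mem_erase.2 ⟨hp0, hst hp⟩⟩
  obtain ⟨hp0, hpt⟩ := Finset.mem_erase.1 hp
  obtain ⟨h1, h2⟩ := ht p hpt (h0 p hp0)
  refine ⟨hp0, ?_, fun q hq => ?_⟩
  · by_cases h : p.derivative = 0
    · exact Or.inr h
    · exact Or.inl (Finset.mem_erase.2 ⟨h, h1⟩)
  · obtain ⟨hq0, hqt⟩ := Finset.mem_erase.1 hq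
    by_cases h : p % q = 0
    · exact Or.inr h
    · exact Or.inl (Finset.mem_erase.2 ⟨h, h2 q hqt (h0 q hq0)⟩)

theorem extend (hI : IVT M) {f g : K →+* M}
    (hfg : ∀ k, SignType.sign (f k) = SignType.sign (g k)) (s : Finset K[X]) (x : M) :
    ∃ y, ∀ p ∈ s, SignType.sign ((p.map f).eval x) = SignType.sign ((p.map g).eval y) := by
  obtain ⟨t, ht, hst⟩ := exists_closed s
  obtain ⟨E, hE⟩ := good_of_closed hI hfg t ht
  obtain ⟨y, hy⟩ := exists_corr E hE.mono x
  refine ⟨y, fun p hp => ?_⟩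
  by_cases hp0 : p = 0
  · simp [hp0]
  · exact gap_sign hI hfg hE (fun q hq => (ht q hq).2.1) hy _ p (hst p hp hp0) rfl

end diag
end RCFAux

namespace RCFAux
open Polynomial

section ext
variable {M : Type*} [Field M] [LinearOrder M] [IsStrictOrderedRing M]

theorem countable_mv (σ : Type*) [Countable σ] : Countable (MvPolynomial σ ℤ) := by
  have : Function.Injective (fun p : MvPolynomial σ ℤ => AddMonoidAlgebra.coeff p) := by
    intro p q h
    exact AddMonoidAlgebra.ext h
  exact this.countable

/-- adding a coordinate to a tuple -/
def oe {σ : Type*} (x : M) (a : σ → M) : Option σ → M := fun o => o.elim x a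

/-- two tuples realize the same signs of polynomials -/
def Sim {σ : Type*} (a b : σ → M) : Prop :=
  ∀ p : MvPolynomial σ ℤ, 0 ≤ MvPolynomial.aeval a p ↔ 0 ≤ MvPolynomial.aeval b p

theorem sign_eq_iff {x y : M} (h1 : 0 ≤ x ↔ 0 ≤ y) (h2 : 0 ≤ -x ↔ 0 ≤ -y) :
    SignType.sign x = SignType.sign y := by
  rw [neg_nonneg, neg_nonneg] at h2
  rcases lt_trichotomy x 0 with h | h | h
  · rw [sign_neg h, sign_neg]
    exact not_le.1 (fun h' => absurd h (not_lt.2 (h1.2 h')))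
  · subst h
    rw [le_antisymm (h2.1 le_rfl) (h1.1 le_rfl)]
  · rw [sign_pos h, sign_pos]
    exact not_le.1 (fun h' => absurd h (not_lt.2 (h2.2 h')))

theorem Sim.sign {σ : Type*} {a b : σ → M} (h : Sim a b) (p : MvPolynomial σ ℤ) :
    SignType.sign (MvPolynomial.aeval a p) = SignType.sign (MvPolynomial.aeval b p) := by
  apply sign_eq_iff (h p)
  rw [← map_neg, ← map_neg]
  exact h (-p)

theorem nonneg_iff_of_sign {x y : M} (h : SignType.sign x = SignType.sign y) : 0 ≤ x ↔ 0 ≤ y := by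
  rw [← sign_nonneg_iff, h, sign_nonneg_iff]

theorem aeval_oe {σ : Type*} (a : σ → M) (x : M) (p : MvPolynomial (Option σ) ℤ) :
    MvPolynomial.aeval (oe x a) p =
      (MvPolynomial.optionEquivLeft ℤ σ p).eval₂ (MvPolynomial.aeval a).toRingHom x := by
  have : (MvPolynomial.aeval (oe x a)).toRingHom =
      (Polynomial.eval₂RingHom (MvPolynomial.aeval a).toRingHom x).comp
        (MvPolynomial.optionEquivLeft ℤ σ).toRingEquiv.toRingHom := by
    apply MvPolynomial.ringHom_ext
    · intro r
      simp
    · intro i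
      cases i with
      | none => simp [oe]
      | some i => simp [oe]
  exact congrArg (fun φ => φ p) this

theorem Sim.exists_field {σ : Type} {a b : σ → M} (h : Sim a b) :
    ∃ (K : Type) (_ : Field K) (i : MvPolynomial σ ℤ →+* K) (f g : K →+* M),
      f.comp i = (MvPolynomial.aeval a).toRingHom ∧ g.comp i = (MvPolynomial.aeval b).toRingHom ∧
      ∀ k, SignType.sign (f k) = SignType.sign (g k) := by
  let φ : MvPolynomial σ ℤ →+* M := (MvPolynomial.aeval a).toRingHom
  let ψ : MvPolynomial σ ℤ →+* M := (MvPolynomial.aeval b).toRingHom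
  have hs : ∀ p, SignType.sign (φ p) = SignType.sign (ψ p) := h.sign
  have h0 : ∀ p, φ p = 0 ↔ ψ p = 0 := fun p => by
    rw [← sign_eq_zero_iff, hs, sign_eq_zero_iff]
  let I := RingHom.ker φ
  have hIp : I.IsPrime := RingHom.ker_isPrime φ
  let A := MvPolynomial σ ℤ ⧸ I
  let f0 : A →+* M := Ideal.Quotient.lift I φ (fun p hp => hp)
  let g0 : A →+* M := Ideal.Quotient.lift I ψ (fun p hp => (h0 p).1 hp)
  have hf0 : Function.Injective f0 := by
    rw [injective_iff_map_eq_zero]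
    intro x hx
    obtain ⟨p, rfl⟩ := Ideal.Quotient.mk_surjective x
    exact Ideal.Quotient.eq_zero_iff_mem.2 hx
  have hg0 : Function.Injective g0 := by
    rw [injective_iff_map_eq_zero]
    intro x hx
    obtain ⟨p, rfl⟩ := Ideal.Quotient.mk_surjective x
    exact Ideal.Quotient.eq_zero_iff_mem.2 ((h0 p).2 hx)
  have hs0 : ∀ x, SignType.sign (f0 x) = SignType.sign (g0 x) := by
    intro x
    obtain ⟨p, rfl⟩ := Ideal.Quotient.mk_surjective x
    exact hs p
  let K := FractionRing A
  refine ⟨K, inferInstance, (algebraMap A K).comp (Ideal.Quotient.mk I),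
    IsFractionRing.lift hf0, IsFractionRing.lift hg0, ?_, ?_, ?_⟩
  · apply RingHom.ext
    intro p
    exact IsFractionRing.lift_algebraMap hf0 (Ideal.Quotient.mk I p)
  · apply RingHom.ext
    intro p
    exact IsFractionRing.lift_algebraMap hg0 (Ideal.Quotient.mk I p)
  · intro k
    obtain ⟨x, y, hy, rfl⟩ := IsFractionRing.div_surjective A k
    have e : ∀ u v : M, SignType.sign (u / v) = SignType.sign u * SignType.sign v := by
      intro u v
      rw [div_eq_mul_inv, sign_mul]
      congr 1
      rcases lt_trichotomy v 0 with h | h | h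
      · rw [sign_neg h, sign_neg (inv_lt_zero.2 h)]
      · simp [h]
      · rw [sign_pos h, sign_pos (inv_pos.2 h)]
    simp only [map_div₀, IsFractionRing.lift_algebraMap, e, hs0]

theorem Sim.extend_fin (hI : IVT M) {σ : Type} {a b : σ → M} (h : Sim a b)
    (s : Finset (MvPolynomial (Option σ) ℤ)) (x : M) :
    ∃ y, ∀ p ∈ s, SignType.sign (MvPolynomial.aeval (oe x a) p) =
      SignType.sign (MvPolynomial.aeval (oe y b) p) := by
  classical
  obtain ⟨K, _, i, f, g, hf, hg, hfg⟩ := h.exists_field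
  obtain ⟨y, hy⟩ := extend hI hfg
    (s.image (fun p => (MvPolynomial.optionEquivLeft ℤ σ p).map i)) x
  refine ⟨y, fun p hp => ?_⟩
  have := hy _ (Finset.mem_image_of_mem _ hp)
  rw [aeval_oe, aeval_oe, ← hf, ← hg]
  simpa only [Polynomial.map_map, Polynomial.eval_map] using this

end ext
end RCFAux

namespace RCFAux
open Polynomial

section alg
variable {M : Type*} [Field M] [LinearOrder M] [IsStrictOrderedRing M]

theorem exists_in_out (hI : IVT M) (S : Set M) (hadd : ∀ x ∈ S, ∀ y ∈ S, x + y ∈ S)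
    (hneg : ∀ x ∈ S, -x ∈ S) (ε : M) (hε : 0 < ε) (hεS : ∀ y, |y| ≤ ε → y ∈ S)
    (w : M) (hw : w ∉ S) (Q : Finset M[X]) :
    ∃ x ∈ S, ∃ x', x' ∉ S ∧ ∀ q ∈ Q, SignType.sign (q.eval x) = SignType.sign (q.eval x') := by
  classical
  let C : Set M := {x | ∀ y, |y| ≤ |x| → y ∈ S}
  have hCS : ∀ x ∈ C, x ∈ S := fun x hx => hx x le_rfl
  have hC2 : ∀ x ∈ C, 2 * x ∈ C := by
    intro x hx y hy
    have h1 : y / 2 ∈ S := by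
      apply hx
      rw [abs_mul, abs_two] at hy
      rw [abs_div, abs_two]
      linarith
    have := hadd _ h1 _ h1
    rwa [add_halves] at this
  have hεC : ε ∈ C := fun y hy => hεS y (by rwa [abs_of_pos hε] at hy)
  have hwC : |w| ∉ C := fun h => hw (h w (by simp))
  have hw0 : 0 < |w| := by
    rw [abs_pos]
    rintro rfl
    exact hw (hεS 0 (by simpa using hε.le))
  let Z : Finset M := (Q.biUnion (fun q => q.roots.toFinset)).filter (fun z => 0 < z)
  have hZ : ∀ q ∈ Q, q ≠ 0 → ∀ c, 0 < c → q.eval c = 0 → c ∈ Z := by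
    intro q hq hq0 c hc h0
    refine Finset.mem_filter.2 ⟨Finset.mem_biUnion.2 ⟨q, hq, ?_⟩, hc⟩
    simp [hq0, h0]
  have hZpos : ∀ z ∈ Z, 0 < z := fun z hz => (Finset.mem_filter.1 hz).2
  obtain ⟨z1, hz1, hz1max⟩ := Finset.exists_max_image (insert ε (Z.filter (fun z => z ∈ C))) id
    (Finset.insert_nonempty _ _)
  obtain ⟨v, hv, hvmin⟩ := Finset.exists_min_image (insert |w| (Z.filter (fun z => z ∉ C))) id
    (Finset.insert_nonempty _ _)
  have hz1C : z1 ∈ C ∧ 0 < z1 := by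
    rcases Finset.mem_insert.1 hz1 with rfl | h
    · exact ⟨hεC, hε⟩
    · exact ⟨(Finset.mem_filter.1 h).2, hZpos _ (Finset.mem_filter.1 h).1⟩
  have hvC : v ∉ C ∧ 0 < v := by
    rcases Finset.mem_insert.1 hv with rfl | h
    · exact ⟨hwC, hw0⟩
    · exact ⟨(Finset.mem_filter.1 h).2, hZpos _ (Finset.mem_filter.1 h).1⟩
  have hxC := hC2 z1 hz1C.1
  have hx0 : 0 < 2 * z1 := by linarith [hz1C.2]
  have hv2 : v / 2 ∉ C := by
    intro h
    apply hvC.1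
    have := hC2 _ h
    rwa [mul_div_cancel₀ _ two_ne_zero] at this
  have : ∃ y, |y| ≤ |v / 2| ∧ y ∉ S := by
    by_contra hcon
    push Not at hcon
    exact hv2 hcon
  obtain ⟨y, hy, hyS⟩ := this
  rw [abs_of_pos (half_pos hvC.2)] at hy
  refine ⟨2 * z1, hCS _ hxC, |y|, ?_, ?_⟩
  · rcases abs_choice y with h | h
    · rwa [h]
    · rw [h]
      intro h'
      have := hneg _ h'
      rw [neg_neg] at this
      exact hyS this
  · intro q hq
    by_cases hq0 : q = 0
    · simp [hq0]
    have hlt : 2 * z1 ≤ |y| := by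
      by_contra hcon
      push Not at hcon
      exact hyS (hxC y (by rw [abs_of_pos hx0]; exact hcon.le))
    apply sign_no_root hI q hlt
    intro c h1 h2 h0
    have hc0 : 0 < c := hx0.trans_le h1
    have hcZ := hZ q hq hq0 c hc0 h0
    by_cases hcC : c ∈ C
    · have := hz1max c (Finset.mem_insert_of_mem (Finset.mem_filter.2 ⟨hcZ, hcC⟩))
      simp only [id] at this
      linarith [hz1C.2]
    · have := hvmin c (Finset.mem_insert_of_mem (Finset.mem_filter.2 ⟨hcZ, hcC⟩))
      simp only [id] at this
      linarith [hvC.2]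

theorem exists_poly {τ : Type*} (c : τ → M) (p : MvPolynomial (τ ⊕ Fin 1) ℤ) :
    ∃ q : M[X], ∀ x, MvPolynomial.aeval (Sum.elim c (fun _ => x)) p = q.eval x := by
  refine ⟨MvPolynomial.aeval (Sum.elim (fun t => C (c t)) (fun _ => X)) p, fun x => ?_⟩
  have : (MvPolynomial.aeval (Sum.elim c (fun _ : Fin 1 => x))).toRingHom =
      (Polynomial.evalRingHom x).comp
        (MvPolynomial.aeval (R := ℤ) (Sum.elim (fun t => C (c t)) (fun _ : Fin 1 => X))).toRingHom := by
    apply MvPolynomial.ringHom_ext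
    · intro r
      simp
    · intro i
      cases i with
      | inl i => simp
      | inr i => simp
  exact congrArg (fun φ => φ p) this

end alg
end RCFAux

namespace PaperGroups
open FirstOrder FirstOrder.Language FirstOrder.Ring RCFAux
variable {M : Type} [Field M] [LinearOrder M] [IsStrictOrderedRing M]

theorem term_poly {α : Type} (t : ordRing.Term α) :
    ∃ p : MvPolynomial α ℤ, ∀ v : α → M, t.realize v = MvPolynomial.aeval v p := by
  induction t with
  | var i => exact ⟨MvPolynomial.X i, fun v => by simp⟩
  | func f ts ih =>
    choose P hP using ih
    rcases f with f | f
    · cases f with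
      | add =>
        refine ⟨P 0 + P 1, fun v => ?_⟩
        rw [map_add, ← hP, ← hP]
        rfl
      | mul =>
        refine ⟨P 0 * P 1, fun v => ?_⟩
        rw [map_mul, ← hP, ← hP]
        rfl
      | neg =>
        refine ⟨-P 0, fun v => ?_⟩
        rw [map_neg, ← hP]
        rfl
      | zero => exact ⟨0, fun v => by rw [map_zero]; rfl⟩
      | one => exact ⟨1, fun v => by rw [map_one]; rfl⟩
    · cases f

theorem poly_term {α : Type} (p : MvPolynomial α ℤ) :
    ∃ t : ordRing.Term α, ∀ v : α → M, t.realize v = MvPolynomial.aeval v p := by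
  have hneg : ∀ p : MvPolynomial α ℤ, (∃ t : ordRing.Term α, ∀ v : α → M,
      t.realize v = MvPolynomial.aeval v p) → (∃ t : ordRing.Term α, ∀ v : α → M,
      t.realize v = MvPolynomial.aeval v (-p)) := by
    rintro p ⟨t, ht⟩
    refine ⟨Term.func (L := ordRing) (l := 1) (Sum.inl ringFunc.neg) ![t], fun v => ?_⟩
    rw [map_neg, ← ht]
    rfl
  have hadd : ∀ p q : MvPolynomial α ℤ, (∃ t : ordRing.Term α, ∀ v : α → M,
      t.realize v = MvPolynomial.aeval v p) → (∃ t : ordRing.Term α, ∀ v : α → M,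
      t.realize v = MvPolynomial.aeval v q) → (∃ t : ordRing.Term α, ∀ v : α → M,
      t.realize v = MvPolynomial.aeval v (p + q)) := by
    rintro p q ⟨t, ht⟩ ⟨u, hu⟩
    refine ⟨Term.func (L := ordRing) (l := 2) (Sum.inl ringFunc.add) ![t, u], fun v => ?_⟩
    rw [map_add, ← ht, ← hu]
    rfl
  have h1 : ∃ t : ordRing.Term α, ∀ v : α → M,
      t.realize v = MvPolynomial.aeval v (1 : MvPolynomial α ℤ) :=
    ⟨Term.func (L := ordRing) (l := 0) (Sum.inl ringFunc.one) ![], fun v => by rw [map_one]; rfl⟩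
  induction p using MvPolynomial.induction_on with
  | C a =>
    induction a using Int.induction_on with
    | zero => exact ⟨Term.func (L := ordRing) (l := 0) (Sum.inl ringFunc.zero) ![],
        fun v => by rw [map_zero, map_zero]; rfl⟩
    | succ n ih =>
      rw [map_add, map_one]
      exact hadd _ _ ih h1
    | pred n ih =>
      rw [sub_eq_add_neg, map_add, map_neg MvPolynomial.C 1, map_one]
      exact hadd _ _ ih (hneg _ h1)
  | add p q hp hq => exact hadd _ _ hp hq
  | mul_X p n hp =>
    obtain ⟨t, ht⟩ := hp
    refine ⟨Term.func (L := ordRing) (l := 2) (Sum.inl ringFunc.mul) ![t, Term.var n], fun v => ?_⟩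
    rw [map_mul, MvPolynomial.aeval_X, ← ht]
    rfl

/-- the order symbol -/
def leR : ordRing.Relations 2 := Sum.inr leSymb

theorem def_nonneg {α : Type} (p : MvPolynomial α ℤ) :
    (∅ : Set M).Definable ordRing {v : α → M | 0 ≤ MvPolynomial.aeval v p} := by
  obtain ⟨t, ht⟩ := poly_term (M := M) p
  obtain ⟨z, hz⟩ := poly_term (M := M) (0 : MvPolynomial α ℤ)
  rw [Set.empty_definable_iff]
  refine ⟨Relations.formula₂ leR z t, ?_⟩
  ext v
  show _ ↔ Formula.Realize _ v
  rw [Formula.realize_rel₂, ht, hz, map_zero]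
  exact Iff.rfl

theorem def_nonneg_comp {α β : Type} (p : MvPolynomial α ℤ) (e : α → β) :
    (∅ : Set M).Definable ordRing {v : β → M | 0 ≤ MvPolynomial.aeval (v ∘ e) p} :=
  (def_nonneg p).preimage_comp e

theorem sat (hsat : Aleph0Saturated ordRing M) {k : ℕ} {τ : Type} [Finite τ] (c : τ → M)
    {J : Type} [Countable J] (X : J → Set ((Fin k ⊕ τ) → M))
    (hX : ∀ j, (∅ : Set M).Definable ordRing (X j))
    (hfin : ∀ s : Finset J, ∃ a : Fin k → M, ∀ j ∈ s, Sum.elim a c ∈ X j) :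
    ∃ a : Fin k → M, ∀ j, Sum.elim a c ∈ X j := by
  classical
  obtain ⟨n, ⟨e⟩⟩ := Finite.exists_equiv_fin τ
  have h1 : ∀ j, ∃ φ : ordRing.Formula (Fin k ⊕ Fin n), ∀ w : Fin k ⊕ Fin n → M,
      φ.Realize w ↔ w ∘ Sum.map id e ∈ X j := by
    intro j
    obtain ⟨φ, hφ⟩ := Set.empty_definable_iff.1 ((hX j).preimage_comp (Sum.map id e))
    refine ⟨φ, fun w => ?_⟩
    have : w ∈ ((fun g : Fin k ⊕ Fin n → M => g ∘ Sum.map id e) ⁻¹' X j) ↔ φ.Realize w := by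
      rw [hφ]; exact Iff.rfl
    exact this.symm
  choose φ hφ using h1
  let F : J → Inst ordRing M (Fin k) := fun j => ⟨n, φ j, c ∘ e.symm⟩
  have hF : ∀ j a, (F j).Holds a ↔ Sum.elim a c ∈ X j := by
    intro j a
    have : Sum.elim a (c ∘ e.symm) ∘ Sum.map id e = Sum.elim a c := by
      ext i
      cases i <;> simp
    rw [← this]
    exact hφ j _
  obtain ⟨a, ha⟩ := hsat k (Set.range F) (Set.countable_range F)
    ⟨Set.range c, Set.finite_range c, by
      rintro _ ⟨j, rfl⟩ i
      exact ⟨e.symm i, rfl⟩⟩ (by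
      intro s hs
      rw [← Set.image_univ] at hs
      obtain ⟨s', -, rfl⟩ := Finset.subset_set_image_iff.1 hs
      obtain ⟨a, ha⟩ := hfin s'
      refine ⟨a, fun I hI => ?_⟩
      obtain ⟨j, hj, rfl⟩ := Finset.mem_image.1 hI
      exact (hF j a).2 (ha j hj))
  exact ⟨a, fun j => (hF j a).1 (ha _ ⟨j, rfl⟩)⟩

theorem sim_extend (hI : IVT M) (hsat : Aleph0Saturated ordRing M) {σ : Type} [Finite σ]
    {a b : σ → M} (h : Sim a b) (x : M) : ∃ y, Sim (oe x a) (oe y b) := by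
  classical
  have := countable_mv (Option σ)
  let e : Option σ → Fin 1 ⊕ σ := fun o => o.elim (Sum.inl 0) Sum.inr
  have he : ∀ y : Fin 1 → M, Sum.elim y b ∘ e = oe (y 0) b := by
    intro y
    ext o
    cases o <;> simp [e, oe]
  obtain ⟨y, hy⟩ := sat hsat b (k := 1) (J := MvPolynomial (Option σ) ℤ)
    (fun p => if 0 ≤ MvPolynomial.aeval (oe x a) p then
      {w : Fin 1 ⊕ σ → M | 0 ≤ MvPolynomial.aeval (w ∘ e) p} else
      {w : Fin 1 ⊕ σ → M | 0 ≤ MvPolynomial.aeval (w ∘ e) p}ᶜ) (by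
      intro p
      split_ifs
      · exact def_nonneg_comp p e
      · exact (def_nonneg_comp p e).compl) (by
      intro s
      obtain ⟨y, hy⟩ := h.extend_fin hI s x
      refine ⟨fun _ => y, fun p hp => ?_⟩
      have := nonneg_iff_of_sign (hy p hp)
      split_ifs with h1
      · simp only [Set.mem_ofPred_eq, he]
        exact this.1 h1
      · simp only [Set.mem_compl_iff, Set.mem_ofPred_eq, he]
        exact fun h2 => h1 (this.2 h2))
  refine ⟨y 0, fun p => ?_⟩
  have := hy p
  split_ifs at this with h1
  · simp only [Set.mem_ofPred_eq, he] at this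
    exact iff_of_true h1 this
  · simp only [Set.mem_compl_iff, Set.mem_ofPred_eq, he] at this
    exact iff_of_false h1 this

theorem Sim_comp {σ ρ : Type} {a b : σ → M} (h : Sim a b) (e : ρ → σ) : Sim (a ∘ e) (b ∘ e) := by
  intro p
  have := h (MvPolynomial.rename e p)
  rwa [MvPolynomial.aeval_rename, MvPolynomial.aeval_rename] at this

theorem Sim_symm {σ : Type} {a b : σ → M} (h : Sim a b) : Sim b a := fun p => (h p).symm

theorem back_forth (hI : IVT M) (hsat : Aleph0Saturated ordRing M) {α : Type} [Finite α]
    {n : ℕ} (φ : ordRing.BoundedFormula α n) : ∀ (v v' : α → M) (xs xs' : Fin n → M),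
    Sim (Sum.elim v xs) (Sum.elim v' xs') → (φ.Realize v xs ↔ φ.Realize v' xs') := by
  induction φ with
  | falsum => intro v v' xs xs' _; exact Iff.rfl
  | equal t₁ t₂ =>
    intro v v' xs xs' h
    obtain ⟨p, hp⟩ := term_poly (M := M) t₁
    obtain ⟨q, hq⟩ := term_poly (M := M) t₂
    show t₁.realize _ = t₂.realize _ ↔ t₁.realize _ = t₂.realize _
    have := h.sign (p - q)
    simp only [map_sub] at this
    rw [hp, hq, hp, hq, ← sub_eq_zero, ← sign_eq_zero_iff, this, sign_eq_zero_iff, sub_eq_zero]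
  | rel R ts =>
    intro v v' xs xs' h
    rcases R with R | R
    · cases R
    · cases R
      obtain ⟨p, hp⟩ := term_poly (M := M) (ts 0)
      obtain ⟨q, hq⟩ := term_poly (M := M) (ts 1)
      show (ts 0).realize _ ≤ (ts 1).realize _ ↔ (ts 0).realize _ ≤ (ts 1).realize _
      have := h (q - p)
      rw [map_sub, map_sub, sub_nonneg, sub_nonneg] at this
      rw [hp, hq, hp, hq]
      exact this
  | imp φ ψ ih1 ih2 =>
    intro v v' xs xs' h
    rw [BoundedFormula.realize_imp, BoundedFormula.realize_imp, ih1 _ _ _ _ h, ih2 _ _ _ _ h]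
  | @all n φ ih =>
    have key : ∀ (v v' : α → M) (xs xs' : Fin n → M),
        Sim (Sum.elim v xs) (Sum.elim v' xs') → φ.all.Realize v xs → φ.all.Realize v' xs' := by
      intro v v' xs xs' h h1
      rw [BoundedFormula.realize_all] at h1 ⊢
      intro y
      obtain ⟨x, hx⟩ := sim_extend hI hsat (Sim_symm h) y
      let e : α ⊕ Fin (n+1) → Option (α ⊕ Fin n) :=
        Sum.elim (fun i => some (Sum.inl i))
          (Fin.lastCases none (fun i => some (Sum.inr i)))
      have he : ∀ (x : M) (v : α → M) (xs : Fin n → M),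
          oe x (Sum.elim v xs) ∘ e = Sum.elim v (Fin.snoc xs x) := by
        intro x v xs
        funext i
        cases i with
        | inl i => rfl
        | inr i =>
          refine Fin.lastCases ?_ (fun i => ?_) i
          · simp [e, oe]
          · simp [e, oe]
      have := Sim_comp (Sim_symm hx) e
      rw [he, he] at this
      exact (ih _ _ _ _ this).1 (h1 x)
    intro v v' xs xs' h
    exact ⟨key _ _ _ _ h, key _ _ _ _ (Sim_symm h)⟩

theorem exists_inf (hsat : Aleph0Saturated ordRing M) : ∃ ε : M, 0 < ε ∧ ε ∈ infinitesimals M := by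
  obtain ⟨a, ha⟩ := sat hsat (k := 1) (τ := Empty) Empty.elim (J := ℕ)
    (fun n => {w : Fin 1 ⊕ Empty → M | 0 ≤ MvPolynomial.aeval w
        (-MvPolynomial.X (Sum.inl 0) : MvPolynomial (Fin 1 ⊕ Empty) ℤ)}ᶜ ∩
      {w : Fin 1 ⊕ Empty → M | 0 ≤ MvPolynomial.aeval w
        ((n : MvPolynomial (Fin 1 ⊕ Empty) ℤ) * MvPolynomial.X (Sum.inl 0) - 1 : MvPolynomial (Fin 1 ⊕ Empty) ℤ)}ᶜ)
    (fun n => (def_nonneg _).compl.inter (def_nonneg _).compl) (by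
      intro s
      have hN : (0 : M) < s.sup id + 1 := by positivity
      refine ⟨fun _ => 1 / (s.sup id + 1), fun n hn => ?_⟩
      have h1 : n ≤ s.sup id := Finset.le_sup (f := id) hn
      have h2 : (n : M) ≤ (s.sup id : ℕ) := by exact_mod_cast h1
      simp only [Set.mem_inter_iff, Set.mem_compl_iff, Set.mem_ofPred_eq, map_neg, map_sub,
        map_mul, map_one, map_natCast, MvPolynomial.aeval_X, Sum.elim_inl, not_le]
      refine ⟨by simpa using hN, ?_⟩
      rw [mul_one_div, sub_neg, div_lt_one hN]
      linarith)
  simp only [Set.mem_inter_iff, Set.mem_compl_iff, Set.mem_ofPred_eq, map_neg, map_sub,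
        map_mul, map_one, map_natCast, MvPolynomial.aeval_X, Sum.elim_inl, not_le] at ha
  have h0 : 0 < a 0 := by simpa using (ha 0).1
  refine ⟨a 0, h0, fun n hn => ?_⟩
  have hn' : (0 : M) < n := by exact_mod_cast hn
  have hp : 0 < 1 / (n : M) := by positivity
  refine ⟨by linarith, ?_⟩
  rw [lt_div_iff₀ hn']
  linarith [(ha n).2]

theorem part1 : (0 : M) ∈ infinitesimals M ∧
      (∀ x ∈ infinitesimals M, ∀ y ∈ infinitesimals M, x + y ∈ infinitesimals M) ∧
      (∀ x ∈ infinitesimals M, -x ∈ infinitesimals M) := by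
  refine ⟨fun n hn => ?_, fun x hx y hy n hn => ?_, fun x hx n hn => ?_⟩
  · have hn' : (0 : M) < n := by exact_mod_cast hn
    have hp : 0 < 1 / (n : M) := by positivity
    exact ⟨by linarith, hp⟩
  · have h1 := hx (2 * n) (by omega)
    have h2 := hy (2 * n) (by omega)
    have e : 1 / ((2 * n : ℕ) : M) = 1 / (n : M) / 2 := by
      push_cast
      rw [div_div, mul_comm]
    rw [e] at h1 h2
    exact ⟨by linarith [h1.1, h2.1], by linarith [h1.2, h2.2]⟩
  · have h1 := hx n hn
    exact ⟨by linarith [h1.2], by linarith [h1.1]⟩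

theorem part2 : TypeDefinableOver ordRing (∅ : Set M) {f : Fin 1 → M | f 0 ∈ infinitesimals M} := by
  let G : ℕ → Set (Fin 1 → M) := fun n =>
    {w : Fin 1 → M | 0 ≤ MvPolynomial.aeval w
        ((n : MvPolynomial (Fin 1) ℤ) * MvPolynomial.X 0 - 1 : MvPolynomial (Fin 1) ℤ)}ᶜ ∩
      {w : Fin 1 → M | 0 ≤ MvPolynomial.aeval w
        (-((n : MvPolynomial (Fin 1) ℤ) * MvPolynomial.X 0) - 1 : MvPolynomial (Fin 1) ℤ)}ᶜ
  have hG : ∀ n : ℕ, 0 < n → ∀ f, f ∈ G n ↔ -(1 / (n : M)) < f 0 ∧ f 0 < 1 / (n : M) := by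
    intro n hn f
    have hn' : (0 : M) < n := by exact_mod_cast hn
    simp only [G, Set.mem_inter_iff, Set.mem_compl_iff, Set.mem_ofPred_eq, map_neg, map_sub,
        map_mul, map_one, map_natCast, MvPolynomial.aeval_X, not_le]
    rw [neg_lt, lt_div_iff₀ hn', lt_div_iff₀ hn']
    constructor
    · rintro ⟨h1, h2⟩
      exact ⟨by linarith, by linarith⟩
    · rintro ⟨h1, h2⟩
      exact ⟨by linarith, by linarith⟩
  refine ⟨{s | ∃ n : ℕ, 0 < n ∧ s = G n}, ?_, ?_⟩
  · rintro s ⟨n, hn, rfl⟩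
    exact (def_nonneg _).compl.inter (def_nonneg _).compl
  · ext f
    rw [Set.mem_sInter]
    constructor
    · rintro h s ⟨n, hn, rfl⟩
      exact (hG n hn f).2 (h n hn)
    · intro h n hn
      exact (hG n hn f).1 (h _ ⟨n, hn, rfl⟩)

theorem part3 (hI : IVT M) (hsat : Aleph0Saturated ordRing M) (S : Set M)
    (hS : (Set.univ : Set M).Definable₁ ordRing S)
    (hadd : ∀ x ∈ S, ∀ y ∈ S, x + y ∈ S) (hneg : ∀ x ∈ S, -x ∈ S)
    (hinf : infinitesimals M ⊆ S) : S = Set.univ := by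
  classical
  by_contra hne
  obtain ⟨w, hw⟩ := (Set.ne_univ_iff_exists_notMem S).1 hne
  obtain ⟨ε, hε, hεi⟩ := exists_inf hsat
  have hεS : ∀ y, |y| ≤ ε → y ∈ S := by
    intro y hy
    apply hinf
    intro n hn
    have := hεi n hn
    have h2 := abs_le.1 hy
    exact ⟨by linarith, by linarith⟩
  obtain ⟨A0, -, hA0⟩ := Set.definable_iff_finitely_definable.1 hS
  obtain ⟨φ, hφ⟩ := Set.definable_iff_exists_formula_sum.1 hA0
  have hφ' : ∀ x : M, x ∈ S ↔ φ.Realize (Sum.elim Subtype.val (fun _ => x)) := by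
    intro x
    have : (fun _ : Fin 1 => x) ∈ {x : Fin 1 → M | x 0 ∈ S} ↔
        φ.Realize (Sum.elim Subtype.val (fun _ => x)) := by
      rw [hφ]; exact Iff.rfl
    exact this
  let c : ↥(A0 : Set M) → M := Subtype.val
  have := countable_mv ((A0 : Set M) ⊕ Fin 1)
  let e : Fin 2 → ((A0 : Set M) ⊕ Fin 1) → (Fin 2 ⊕ (A0 : Set M)) :=
    fun i => Sum.elim Sum.inr (fun _ => Sum.inl i)
  have he : ∀ (a : Fin 2 → M) (i : Fin 2), Sum.elim a c ∘ e i = Sum.elim c (fun _ => a i) := by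
    intro a i
    ext j
    cases j <;> rfl
  have hdφ : ∀ i, (∅ : Set M).Definable ordRing {v : (Fin 2 ⊕ (A0 : Set M)) → M | φ.Realize (v ∘ e i)} := by
    intro i
    have : (∅ : Set M).Definable ordRing {v : ((A0 : Set M) ⊕ Fin 1) → M | φ.Realize v} :=
      Set.empty_definable_iff.2 ⟨φ, rfl⟩
    exact this.preimage_comp (e i)
  let P : MvPolynomial ((A0 : Set M) ⊕ Fin 1) ℤ → Fin 2 → Set ((Fin 2 ⊕ (A0 : Set M)) → M) :=
    fun p i => {v | 0 ≤ MvPolynomial.aeval (v ∘ e i) p}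
  obtain ⟨a, ha⟩ := sat hsat (k := 2) c
    (J := Option (MvPolynomial ((A0 : Set M) ⊕ Fin 1) ℤ))
    (fun o => o.elim ({v | φ.Realize (v ∘ e 0)} ∩ {v | φ.Realize (v ∘ e 1)}ᶜ)
      (fun p => (P p 0 ∩ P p 1) ∪ ((P p 0)ᶜ ∩ (P p 1)ᶜ))) (by
      intro o
      cases o with
      | none => exact (hdφ 0).inter (hdφ 1).compl
      | some p =>
        exact ((def_nonneg_comp p (e 0)).inter (def_nonneg_comp p (e 1))).union
          ((def_nonneg_comp p (e 0)).compl.inter (def_nonneg_comp p (e 1)).compl)) (by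
      intro s
      choose q hq using fun p => exists_poly c p
      obtain ⟨x, hx, x', hx', hs⟩ := exists_in_out hI S hadd hneg ε hε hεS w hw
        (s.biUnion (fun o => o.elim ∅ (fun p => {q p})))
      refine ⟨![x, x'], fun o ho => ?_⟩
      cases o with
      | none =>
        refine ⟨?_, fun h => hx' ((hφ' x').2 ?_)⟩
        · show φ.Realize (Sum.elim ![x, x'] c ∘ e 0)
          rw [he]
          exact (hφ' x).1 hx
        · change φ.Realize (Sum.elim ![x, x'] c ∘ e 1) at h
          rw [he] at h
          exact h
      | some p =>
        have h1 := nonneg_iff_of_sign (hs (q p) (Finset.mem_biUnion.2 ⟨some p, ho, by simp⟩))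
        rw [← hq, ← hq] at h1
        have h2 : ∀ i, Sum.elim ![x, x'] c ∈ P p i ↔
            0 ≤ MvPolynomial.aeval (Sum.elim c (fun _ => (![x, x'] : Fin 2 → M) i)) p := by
          intro i
          rw [← he]
          exact Iff.rfl
        have h3 : Sum.elim ![x, x'] c ∈ P p 0 ↔ Sum.elim ![x, x'] c ∈ P p 1 := by
          rw [h2, h2]; exact h1
        by_cases h4 : Sum.elim ![x, x'] c ∈ P p 0
        · exact Or.inl ⟨h4, h3.1 h4⟩
        · exact Or.inr ⟨h4, fun h => h4 (h3.2 h)⟩)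
  have hsim : Sim (Sum.elim c (fun _ : Fin 1 => a 0)) (Sum.elim c (fun _ : Fin 1 => a 1)) := by
    intro p
    rw [← he, ← he]
    rcases ha (some p) with ⟨h1, h2⟩ | ⟨h1, h2⟩
    · exact iff_of_true h1 h2
    · exact iff_of_false h1 h2
  obtain ⟨h1, h2⟩ := ha none
  change φ.Realize (Sum.elim a c ∘ e 0) at h1
  change ¬ φ.Realize (Sum.elim a c ∘ e 1) at h2
  rw [he] at h1 h2
  refine h2 ((back_forth hI hsat φ _ _ _ _ ?_).1 h1)
  let e' : ((A0 : Set M) ⊕ Fin 1) ⊕ Fin 0 → (A0 : Set M) ⊕ Fin 1 := Sum.elim id Fin.elim0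
  have := Sim_comp hsim e'
  have he' : ∀ u : (A0 : Set M) ⊕ Fin 1 → M, u ∘ e' = Sum.elim u default := by
    intro u
    ext j
    rcases j with j | j
    · rfl
    · exact j.elim0
  rwa [he', he'] at this

end PaperGroups

namespace PaperGroups

open FirstOrder FirstOrder.Language FirstOrder.Ring

variable {M : Type} [Field M] [LinearOrder M] [IsStrictOrderedRing M]

/-- **Remark (counter-example).** In an `ℵ₀`-saturated real closed field `M`, the group
`I` of infinitesimals is an `∞`-definable subgroup of the additive group `(M,+)`, but no
proper definable subgroup of `(M,+)` contains `I`: every definable (with parameters)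
subgroup of `(M,+)` containing `I` is all of `M`. -/
theorem infinitesimals_infty_definable_subgroup_and_no_proper_definable_subgroup
    (hRC : IsRealClosed M) (hsat : Aleph0Saturated ordRing M) :
    -- `I` is a subgroup of `(M, +)`
    ((0 : M) ∈ infinitesimals M ∧
      (∀ x ∈ infinitesimals M, ∀ y ∈ infinitesimals M, x + y ∈ infinitesimals M) ∧
      (∀ x ∈ infinitesimals M, -x ∈ infinitesimals M)) ∧
    -- `I` is `∞`-definable (without parameters)
    TypeDefinableOver ordRing (∅ : Set M)
      {f : Fin 1 → M | f 0 ∈ infinitesimals M} ∧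
    -- no proper definable subgroup of `(M,+)` contains `I`
    (∀ S : Set M, (Set.univ : Set M).Definable₁ ordRing S →
      (0 : M) ∈ S → (∀ x ∈ S, ∀ y ∈ S, x + y ∈ S) → (∀ x ∈ S, -x ∈ S) →
      infinitesimals M ⊆ S → S = Set.univ) := by
  have hI : RCFAux.IVT M := fun p a b hab h => RCFAux.ivt_aux hRC.1 hRC.2 p a b hab h
  exact ⟨part1, part2, fun S hS _ hadd hneg hinf => part3 hI hsat S hS hadd hneg hinf⟩

end PaperGroups
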